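/- arXiv:1904.06911 — 2 statements merged into one kernel-verified Lean document; each statement's English description precedes it below -/
import Mathlib

section
/- Let P be a centrally symmetric convex polygon in ℝ² with exactly 14 vertices. Then for every lattice Λ ⊆ ℝ² and every positive integer k ≤ 6, P + Λ is not a k-fold lattice tiling of ℝ²; that is, τ*(P) ≥ 7. -/
open Set Pointwise

noncomputable section

/-- A point of the plane `ℝ²`. -/
abbrev Pt : Type := ℝ × ℝ

/-- The standard integer lattice `ℤ² ⊆ ℝ²`. -/
def IntLattice : Set Pt := {p : Pt | ∃ a b : ℤ, p = ((a : ℝ), (b : ℝ))}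

/-- A lattice in `ℝ²` is the image of `ℤ²` under an invertible linear map. -/
def IsLattice (L : Set Pt) : Prop :=
  ∃ B : Pt ≃ₗ[ℝ] Pt, L = B '' IntLattice

/-- `K + L` is a `k`-fold lattice tiling of the plane: `L` is a lattice, every point lies in
at least `k` translates `K + l` (`l ∈ L`), and every point lies in at most `k` translates
`interior K + l`. -/
def IsKFoldLatticeTiling (K L : Set Pt) (k : ℕ) : Prop :=
  IsLattice L ∧
  (∀ p : Pt, (k : ℕ∞) ≤ {l ∈ L | p - l ∈ K}.encard) ∧
  (∀ p : Pt, {l ∈ L | p - l ∈ interior K}.encard ≤ (k : ℕ∞))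

/-- A discrete multiset of points of the plane, given as a family `x : I → ℝ²`:
every bounded set contains `x i` for only finitely many indices. -/
def IsDiscreteFamily {I : Type} (x : I → Pt) : Prop :=
  ∀ B : Set Pt, Bornology.IsBounded B → {i : I | x i ∈ B}.Finite

/-- `K + X` is a `k`-fold translative tiling of the plane, for the discrete multiset
`X = (x i)_{i ∈ I}`: every point lies in `K + x i` for at least `k` indices, and in
`interior K + x i` for at most `k` indices. -/
def IsKFoldTranslativeTiling {I : Type} (K : Set Pt) (x : I → Pt) (k : ℕ) : Prop :=
  IsDiscreteFamily x ∧
  (∀ p : Pt, (k : ℕ∞) ≤ {i : I | p - x i ∈ K}.encard) ∧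
  (∀ p : Pt, {i : I | p - x i ∈ interior K}.encard ≤ (k : ℕ∞))

/-- A convex polygon with exactly `n` vertices: a compact convex set with nonempty interior
which is the convex hull of its finitely many (`n`) extreme points. -/
def IsConvexPolygon (P : Set Pt) (n : ℕ) : Prop :=
  Convex ℝ P ∧ IsCompact P ∧ (interior P).Nonempty ∧
  (Set.extremePoints ℝ P).Finite ∧ (Set.extremePoints ℝ P).ncard = n ∧
  P = convexHull ℝ (Set.extremePoints ℝ P)

/-- `[a, b]` is an edge of the polygon `P`: a nondegenerate segment which is an extreme
(face) subset of `P`. -/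
def IsEdgeOf (P : Set Pt) (a b : Pt) : Prop :=
  a ≠ b ∧ IsExtreme ℝ P (segment ℝ a b)

/-- The set of midpoints of the edges of `P`. -/
def edgeMidpoints (P : Set Pt) : Set Pt :=
  {u : Pt | ∃ a b : Pt, IsEdgeOf P a b ∧ u = midpoint ℝ a b}

/-- `P` is centrally symmetric (about some center `c`). -/
def CentrallySymmetric (P : Set Pt) : Prop :=
  ∃ c : Pt, ∀ x : Pt, x ∈ P ↔ c + c - x ∈ P

/-- `D` is a parallelogram. -/
def IsParallelogram (D : Set Pt) : Prop :=
  ∃ v a b : Pt, LinearIndependent ℝ ![a, b] ∧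
    D = convexHull ℝ ({v, v + a, v + b, v + a + b} : Set Pt)

/-- The octagon `P₈(α)`, with vertices `±(α−1, 2), ±(α, −2), ±(1−α, 0), ±(1+α, −1)`. -/
def P8 (α : ℝ) : Set Pt :=
  convexHull ℝ ({(α - 1, 2), (α, -2), (1 - α, 0), (1 + α, -1),
                 (1 - α, -2), (-α, 2), (α - 1, 0), (-(1 + α), 1)} : Set Pt)

/-- The ten points `D₁`. -/
def D1 : Set Pt :=
  {(-1, 1/2), (1/2, 1), (3/2, 1), (2, 1/2), (2, 0),
   (1, -1/2), (-1/2, -1), (-3/2, -1), (-2, -1/2), (-2, 0)}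

/-- The ten points `D₂`. -/
def D2 : Set Pt :=
  {(1/2, -1), (3/2, -1/2), (2, 0), (3/2, 1/2), (1/2, 1),
   (-1/2, 1), (-3/2, 1/2), (-2, 0), (-3/2, -1/2), (-1/2, -1)}

/-- The set `(1/2)Λ = {λ/2 : λ ∈ Λ}`. -/
def halfSet (L : Set Pt) : Set Pt := (fun l : Pt => (2⁻¹ : ℝ) • l) '' L

/-- A cyclic enumeration `v : ZMod n → ℝ²` of the vertices of a convex polygon `P` with `n`
vertices: `v` is injective, its range is the vertex set of `P`, and consecutive vertices are
joined by edges of `P`. -/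
def IsCyclicVertexEnum (P : Set Pt) (n : ℕ) (v : ZMod n → Pt) : Prop :=
  Function.Injective v ∧ Set.range v = Set.extremePoints ℝ P ∧
  ∀ i : ZMod n, IsEdgeOf P (v i) (v (i + 1))

def dt (x y : Pt) : ℝ := x.1 * y.2 - x.2 * y.1

lemma not_ext_of_interior {P : Set Pt} {v : Pt} (hv : v ∈ interior P)
    (he : v ∈ Set.extremePoints ℝ P) : False := by
  have hc : ∀ w : Pt, ∃ ε > (0:ℝ), v + ε • w ∈ P ∧ v - ε • w ∈ P := by
    intro w
    have h1 : Filter.Tendsto (fun ε : ℝ => v + ε • w) (nhdsWithin 0 (Set.Ioi 0)) (nhds v) := by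
      have : ContinuousAt (fun ε : ℝ => v + ε • w) 0 := by fun_prop
      have h := this.tendsto
      simp only [zero_smul, add_zero] at h
      exact h.mono_left nhdsWithin_le_nhds
    have h2 : Filter.Tendsto (fun ε : ℝ => v - ε • w) (nhdsWithin 0 (Set.Ioi 0)) (nhds v) := by
      have : ContinuousAt (fun ε : ℝ => v - ε • w) 0 := by fun_prop
      have h := this.tendsto
      simp only [zero_smul, sub_zero] at h
      exact h.mono_left nhdsWithin_le_nhds
    have hP := mem_interior_iff_mem_nhds.1 hv
    have := ((h1.eventually hP).and (h2.eventually hP)).and self_mem_nhdsWithin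
    obtain ⟨ε, ⟨ha, hb⟩, hc⟩ := this.exists
    exact ⟨ε, hc, ha, hb⟩
  obtain ⟨ε, hε, ha, hb⟩ := hc (1, 0)
  have := he.2 ha hb ⟨1/2, 1/2, by norm_num, by norm_num, by norm_num, by
    ext <;> simp <;> ring⟩
  have h1 := congrArg Prod.fst this
  simp at h1
  exact hε.ne' h1

lemma smul_mem_int {P : Set Pt} (hc : Convex ℝ P) (h0 : (0:Pt) ∈ interior P) {x : Pt}
    (hx : x ∈ P) {s : ℝ} (hs0 : 0 ≤ s) (hs : s < 1) : s • x ∈ interior P := by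
  have := hc.combo_interior_self_mem_interior h0 hx (a := 1 - s) (b := s) (by linarith) hs0
    (by ring)
  simpa using this

lemma combo_mem_int {P : Set Pt} (hc : Convex ℝ P) (h0 : (0:Pt) ∈ interior P) {a b : Pt}
    (ha : a ∈ P) (hb : b ∈ P) {p q : ℝ} (hp : 0 ≤ p) (hq : 0 ≤ q) (hpq : p + q < 1) :
    p • a + q • b ∈ interior P := by
  by_cases h : p + q = 0
  · have h1 : p = 0 := by linarith
    have h2 : q = 0 := by linarith
    subst h1 h2; simpa using h0
  · have hpos : 0 < p + q := lt_of_le_of_ne (by linarith) (Ne.symm h)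
    have hy : (p / (p+q)) • a + (q / (p+q)) • b ∈ P :=
      hc ha hb (by positivity) (by positivity) (by field_simp)
    have := smul_mem_int hc h0 hy hpos.le hpq
    convert this using 1
    rw [smul_add, smul_smul, smul_smul]
    congr 2 <;> field_simp

lemma ext0 {P : Set Pt} (hc : Convex ℝ P) (h0 : (0:Pt) ∈ interior P) {v a b : Pt}
    (hv : v ∈ Set.extremePoints ℝ P) (ha : a ∈ P) (hb : b ∈ P) {p q : ℝ} (hp : 0 ≤ p)
    (hq : 0 ≤ q) (hpq : p + q ≤ 1) (h : v = p • a + q • b) : v = a ∨ v = b := by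
  rcases lt_or_eq_of_le hpq with h1 | h1
  · exact (not_ext_of_interior (h ▸ combo_mem_int hc h0 ha hb hp hq h1) hv).elim
  · rcases hp.eq_or_lt with hp0 | hp0
    · right; subst hp0; rw [h]; simp at h1; simp [h1]
    rcases hq.eq_or_lt with hq0 | hq0
    · left; subst hq0; rw [h]; simp at h1; simp [h1]
    left
    exact (hv.2 ha hb ⟨p, q, hp0, hq0, h1, h.symm⟩).symm

/-- The cyclic vertex sequence. -/
def vseq (f : Fin 7 → Pt) (n : ℕ) : Pt :=
  ((-1 : ℝ) ^ (n / 7)) • f ⟨n % 7, Nat.mod_lt _ (by norm_num)⟩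

lemma vseq_add (f : Fin 7 → Pt) (n : ℕ) : vseq f (n + 7) = - vseq f n := by
  unfold vseq
  rw [Nat.add_div_right _ (by norm_num), pow_succ]
  simp

lemma dt_neg_left (x y : Pt) : dt (-x) y = - dt x y := by simp [dt]; ring
lemma dt_neg_right (x y : Pt) : dt x (-y) = - dt x y := by simp [dt]; ring
lemma dt_swap (x y : Pt) : dt x y = - dt y x := by simp [dt]; ring
lemma dt_smul_smul (a b : ℝ) (x y : Pt) : dt (a • x) (b • y) = a * b * dt x y := by
  simp [dt]; ring

lemma vseq_pos (f : Fin 7 → Pt) (hf : ∀ i j, i < j → 0 < dt (f i) (f j)) {i j : ℕ}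
    (hij : i < j) (hj : j < i + 7) : 0 < dt (vseq f i) (vseq f j) := by
  unfold vseq
  rw [dt_smul_smul]
  rcases Nat.lt_or_ge (i % 7) (j % 7) with h | h
  · have : i / 7 = j / 7 := by omega
    rw [this, ← pow_add, ← two_mul, pow_mul]
    simp only [even_two, Even.neg_pow, one_pow, one_mul]
    exact hf _ _ h
  · have : j / 7 = i / 7 + 1 := by omega
    rw [this, ← pow_add, ← add_assoc, pow_succ, ← two_mul, pow_mul, dt_swap]
    have hlt : (⟨j % 7, Nat.mod_lt _ (by norm_num)⟩ : Fin 7) < ⟨i % 7, Nat.mod_lt _ (by norm_num)⟩ := by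
      show j % 7 < i % 7
      omega
    have := hf _ _ hlt
    simpa using this

/-- sort key on the half plane -/
def hkey (x : Pt) : ℝ := x.2 / (x.1 + |x.2|)

def inH (x : Pt) : Prop := 0 < x.1 ∨ (x.1 = 0 ∧ 0 < x.2)

lemma inH_den {x : Pt} (hx : inH x) : 0 < x.1 + |x.2| := by
  rcases hx with h | ⟨h, h'⟩
  · positivity
  · rw [h, abs_of_pos h']; linarith

lemma inH_nonneg {x : Pt} (hx : inH x) : 0 ≤ x.1 := by
  rcases hx with h | ⟨h, h'⟩ <;> linarith

lemma hkey_lt {x y : Pt} (hx : inH x) (hy : inH y) (h : hkey x < hkey y) : 0 ≤ dt x y := by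
  unfold hkey at h
  rw [div_lt_div_iff₀ (inH_den hx) (inH_den hy)] at h
  have h1 := inH_nonneg hx
  have h2 := inH_nonneg hy
  unfold dt
  rcases abs_cases x.2 with ⟨e1, l1⟩ | ⟨e1, l1⟩ <;> rcases abs_cases y.2 with ⟨e2, l2⟩ | ⟨e2, l2⟩ <;>
    rw [e1, e2] at h <;> nlinarith [mul_nonneg h1 h2]

lemma hkey_eq {x y : Pt} (hx : inH x) (hy : inH y) (h : hkey x = hkey y) : dt x y = 0 := by
  unfold hkey at h
  rw [div_eq_div_iff (inH_den hx).ne' (inH_den hy).ne'] at h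
  have h1 := inH_nonneg hx
  have h2 := inH_nonneg hy
  unfold dt
  rcases abs_cases x.2 with ⟨e1, l1⟩ | ⟨e1, l1⟩ <;> rcases abs_cases y.2 with ⟨e2, l2⟩ | ⟨e2, l2⟩ <;>
    rw [e1, e2] at h
  · linarith
  · exfalso
    have : 0 < x.2 ∨ x.2 = 0 := l1.lt_or_eq.imp id Eq.symm
    have hh : x.2 * (-y.2) ≥ 0 := by nlinarith
    have h3 : y.2 * x.1 ≤ 0 := by nlinarith
    have h4 : x.2 * y.1 ≥ 0 := by positivity
    have h5 : x.2 * y.2 = 0 := by nlinarith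
    have h6 : y.2 * x.1 = 0 := by nlinarith
    rcases mul_eq_zero.1 h5 with h7 | h7
    · rcases mul_eq_zero.1 h6 with h8 | h8
      · linarith
      · rcases hx with hx | ⟨hx, hx'⟩ <;> linarith
    · linarith
  · exfalso
    have hh : x.2 * (y.2) ≤ 0 := by nlinarith
    have h3 : y.2 * x.1 ≥ 0 := by positivity
    have h4 : x.2 * y.1 ≤ 0 := by nlinarith
    have h5 : x.2 * y.2 = 0 := by nlinarith
    have h6 : x.2 * y.1 = 0 := by nlinarith
    rcases mul_eq_zero.1 h5 with h7 | h7
    · linarith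
    · rcases mul_eq_zero.1 h6 with h8 | h8
      · linarith
      · rcases hy with hy | ⟨hy, hy'⟩ <;> linarith
  · linarith

/-- Parallel points of the half plane, both extreme, coincide. -/
lemma inH_par {P : Set Pt} (hc : Convex ℝ P) (h0 : (0:Pt) ∈ interior P) {x y : Pt}
    (hxe : x ∈ Set.extremePoints ℝ P) (hye : y ∈ Set.extremePoints ℝ P)
    (hx : inH x) (hy : inH y) (h : dt x y = 0) : x = y := by
  obtain ⟨r, hr, hxy⟩ : ∃ r : ℝ, 0 < r ∧ x = r • y := by
    unfold dt at h
    by_cases hy1 : y.1 = 0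
    · have hy2 : 0 < y.2 := by rcases hy with hy | hy; · linarith
                               · exact hy.2
      have hx1 : x.1 = 0 := by
        rw [hy1] at h
        have : x.1 * y.2 = 0 := by linarith
        rcases mul_eq_zero.1 this with h | h
        · exact h
        · linarith
      have hx2 : 0 < x.2 := by rcases hx with hx | hx; · linarith
                               · exact hx.2
      exact ⟨x.2 / y.2, by positivity, by ext <;> simp [hx1, hy1]; field_simp⟩
    · have hyp : 0 < y.1 := lt_of_le_of_ne (inH_nonneg hy) (Ne.symm hy1)
      have hx1 : 0 < x.1 := by
        rcases hx with hx | hx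
        · exact hx
        · rw [hx.1] at h
          have : 0 < x.2 * y.1 := mul_pos hx.2 hyp
          linarith
      refine ⟨x.1 / y.1, by positivity, ?_⟩
      ext
      · simp; field_simp
      · simp; field_simp; linarith
  rcases le_or_gt r 1 with h1 | h1
  · rcases ext0 hc h0 hxe hye.1 hye.1 (p := r) (q := 0) hr.le le_rfl (by linarith) (by simpa using hxy) with h | h <;>
      exact h
  · have hyx : y = r⁻¹ • x + (0:ℝ) • x := by rw [hxy, smul_smul, inv_mul_cancel₀ hr.ne']; simp
    rcases ext0 hc h0 hye hxe.1 hxe.1 (by positivity) le_rfl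
      (by simpa using inv_le_one_of_one_le₀ h1.le) hyx with h | h <;> exact h.symm

lemma exists_sorted {P : Set Pt} (hc : Convex ℝ P) (h0 : (0:Pt) ∈ interior P)
    (hsym : ∀ x ∈ P, -x ∈ P)
    (hfin : (Set.extremePoints ℝ P).Finite) (hcard : (Set.extremePoints ℝ P).ncard = 14) :
    ∃ f : Fin 7 → Pt, (∀ i j, i < j → 0 < dt (f i) (f j)) ∧
      (∀ i, f i ∈ Set.extremePoints ℝ P) ∧
      (∀ u ∈ Set.extremePoints ℝ P, ∃ i, u = f i ∨ u = - f i) := by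
  classical
  have hneg : ∀ x ∈ Set.extremePoints ℝ P, -x ∈ Set.extremePoints ℝ P := by
    intro x hx
    refine ⟨hsym x hx.1, ?_⟩
    intro a ha b hb hab
    have := hx.2 (hsym a ha) (hsym b hb) (by
      obtain ⟨p, q, hp, hq, hpq, h⟩ := hab
      refine ⟨p, q, hp, hq, hpq, ?_⟩
      rw [smul_neg, smul_neg, ← neg_add, h, neg_neg])
    rw [← this, neg_neg]
  have hne0 : ∀ x ∈ Set.extremePoints ℝ P, x ≠ 0 := by
    rintro x hx rfl
    exact not_ext_of_interior h0 hx
  set E := hfin.toFinset with hE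
  have memE : ∀ x, x ∈ E ↔ x ∈ Set.extremePoints ℝ P := fun x => hfin.mem_toFinset
  have hEc : E.card = 14 := by rw [← hcard, Set.ncard_eq_toFinset_card _ hfin]
  have hH : ∀ x : Pt, x ≠ 0 → (inH (-x) ↔ ¬ inH x) := by
    intro x hx
    unfold inH
    have : x.1 ≠ 0 ∨ x.2 ≠ 0 := by
      by_contra! h
      exact hx (Prod.ext h.1 h.2)
    simp only [Prod.fst_neg, Prod.snd_neg]
    constructor
    · rintro (h | ⟨h, g⟩) (h' | ⟨h', g'⟩) <;> linarith
    · intro h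
      push Not at h
      rcases h.1.lt_or_eq with h1 | h1
      · left; linarith
      · right
        refine ⟨by linarith, ?_⟩
        have := h.2 h1
        rcases this.lt_or_eq with h2 | h2
        · linarith
        · tauto
  set A := E.filter inH with hA
  have hB : E.filter (fun x => ¬ inH x) = A.image (fun x => -x) := by
    ext x
    simp only [Finset.mem_filter, Finset.mem_image, hA, memE]
    constructor
    · rintro ⟨hx, hn⟩
      exact ⟨-x, ⟨hneg x hx, (hH x (hne0 x hx)).2 hn⟩, neg_neg x⟩
    · rintro ⟨y, ⟨hy, hyH⟩, rfl⟩
      refine ⟨hneg y hy, ?_⟩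
      rw [hH y (hne0 y hy)]
      simpa using hyH
  have hAc : A.card = 7 := by
    have := Finset.card_filter_add_card_filter_not (s := E) inH
    rw [hB, Finset.card_image_of_injective _ neg_injective, hEc] at this
    change A.card + A.card = 14 at this
    omega
  have hinj : Set.InjOn hkey (A : Set Pt) := by
    intro x hx y hy hxy
    have hx' := Finset.mem_filter.1 (Finset.mem_coe.1 hx)
    have hy' := Finset.mem_filter.1 (Finset.mem_coe.1 hy)
    exact inH_par hc h0 ((memE x).1 hx'.1) ((memE y).1 hy'.1) hx'.2 hy'.2
      (hkey_eq hx'.2 hy'.2 hxy)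
  have hSc : (A.image hkey).card = 7 := by rw [Finset.card_image_of_injOn hinj, hAc]
  have hch : ∀ i : Fin 7, ∃ x ∈ A, hkey x = (A.image hkey).orderEmbOfFin hSc i := by
    intro i
    have := Finset.orderEmbOfFin_mem (A.image hkey) hSc i
    exact Finset.mem_image.1 this
  choose f hfA hfk using hch
  have hfA' : ∀ i, f i ∈ Set.extremePoints ℝ P ∧ inH (f i) := fun i => by
    have := Finset.mem_filter.1 (hfA i)
    exact ⟨(memE _).1 this.1, this.2⟩
  have hall : ∀ x ∈ A, ∃ i, x = f i := by
    intro x hx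
    have h1 : hkey x ∈ Set.range ((A.image hkey).orderEmbOfFin hSc) := by
      rw [Finset.range_orderEmbOfFin]
      exact Finset.mem_coe.2 (Finset.mem_image_of_mem _ hx)
    obtain ⟨i, hi⟩ := h1
    exact ⟨i, hinj hx (hfA i) (by rw [hfk, hi])⟩
  refine ⟨f, ?_, fun i => (hfA' i).1, ?_⟩
  · intro i j hij
    have hlt : hkey (f i) < hkey (f j) := by
      rw [hfk, hfk]
      exact ((A.image hkey).orderEmbOfFin hSc).strictMono hij
    refine lt_of_le_of_ne (hkey_lt (hfA' i).2 (hfA' j).2 hlt) ?_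
    intro h
    have := inH_par hc h0 (hfA' i).1 (hfA' j).1 (hfA' i).2 (hfA' j).2 h.symm
    rw [this] at hlt
    exact lt_irrefl _ hlt
  · intro u hu
    by_cases huH : inH u
    · obtain ⟨i, hi⟩ := hall u (Finset.mem_filter.2 ⟨(memE u).2 hu, huH⟩)
      exact ⟨i, Or.inl hi⟩
    · obtain ⟨i, hi⟩ := hall (-u) (Finset.mem_filter.2 ⟨(memE _).2 (hneg u hu),
        (hH u (hne0 u hu)).2 huH⟩)
      exact ⟨i, Or.inr (by rw [← hi, neg_neg])⟩

lemma dt_sub_right (x a b : Pt) : dt x (b - a) = dt x b - dt x a := by simp [dt]; ring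
lemma dt_sub_left (x a b : Pt) : dt (b - a) x = dt b x - dt a x := by simp [dt]; ring

lemma cramer (a b u : Pt) : dt a b • u = dt u b • a + dt a u • b := by
  ext <;> simp [dt] <;> ring

/-- The vertex data of a centrally symmetric tetradecagon. -/
structure VData (P : Set Pt) (v : ℕ → Pt) : Prop where
  per : ∀ n, v (n + 7) = - v n
  mem : ∀ n, v n ∈ P
  pos : ∀ i j, i < j → j < i + 7 → 0 < dt (v i) (v j)
  strict : ∀ i j, i + 2 ≤ j → j ≤ i + 13 →
    dt (v j) (v (i + 1) - v i) < dt (v i) (v (i + 1))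
  face : ∀ i, ∀ x ∈ P, dt x (v (i + 1) - v i) < dt (v i) (v (i + 1)) ∨
    x ∈ segment ℝ (v i) (v (i + 1))

lemma dt_seg {a b x : Pt} (hx : x ∈ segment ℝ a b) : dt x (b - a) = dt a b := by
  obtain ⟨p, q, hp, hq, hpq, rfl⟩ := hx
  have : p = 1 - q := by linarith
  subst this
  simp [dt]; ring

lemma strict_aux {P : Set Pt} (hc : Convex ℝ P) (h0 : (0:Pt) ∈ interior P) {a b u : Pt}
    (hb : b ∈ Set.extremePoints ℝ P) (ha : a ∈ P) (hu : u ∈ P)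
    (hab : 0 < dt a b) (hau : 0 < dt a u) (hbu : 0 < dt b u) :
    dt u (b - a) < dt a b := by
  by_contra! h
  rw [dt_sub_right, dt_swap u b, dt_swap u a] at h
  have hcr := cramer a b u
  have hbb : b = (dt b u / dt a u) • a + (dt a b / dt a u) • u := by
    have h2 : dt a u • b = dt b u • a + dt a b • u := by
      rw [hcr, dt_swap u b]; ext <;> simp
    have := congrArg (fun z => (dt a u)⁻¹ • z) h2
    simp only [smul_add, smul_smul] at this
    rw [inv_mul_cancel₀ hau.ne', one_smul] at this
    simp only [div_eq_inv_mul]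
    exact this
  rcases ext0 hc h0 hb ha hu (by positivity) (by positivity)
    (by rw [← add_div, div_le_one hau]; linarith) hbb with h3 | h3
  · rw [h3] at hab; simp [dt, mul_comm] at hab
  · rw [h3] at hbu; simp [dt, mul_comm] at hbu

lemma strict_aux' {P : Set Pt} (hc : Convex ℝ P) (h0 : (0:Pt) ∈ interior P) {a b u : Pt}
    (ha : a ∈ Set.extremePoints ℝ P) (hb : b ∈ P) (hu : u ∈ P)
    (hab : 0 < dt a b) (hua : 0 < dt u a) (hub : 0 < dt u b) :
    dt u (b - a) < dt a b := by
  by_contra! h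
  rw [dt_sub_right] at h
  have hcr := cramer a b u
  have hbb : a = (dt u a / dt u b) • b + (dt a b / dt u b) • u := by
    have h2 : dt u b • a = dt u a • b + dt a b • u := by
      rw [hcr, dt_swap a u]; ext <;> simp
    have := congrArg (fun z => (dt u b)⁻¹ • z) h2
    simp only [smul_add, smul_smul] at this
    rw [inv_mul_cancel₀ hub.ne', one_smul] at this
    simp only [div_eq_inv_mul]
    exact this
  rcases ext0 hc h0 ha hb hu (by positivity) (by positivity)
    (by rw [← add_div, div_le_one hub]; linarith) hbb with h3 | h3
  · rw [h3] at hab; simp [dt, mul_comm] at hab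
  · rw [h3] at hua; simp [dt, mul_comm] at hua

lemma exists_vdata {P : Set Pt} (hc : Convex ℝ P) (h0 : (0:Pt) ∈ interior P)
    (hsym : ∀ x ∈ P, -x ∈ P)
    (hfin : (Set.extremePoints ℝ P).Finite) (hcard : (Set.extremePoints ℝ P).ncard = 14)
    (hhull : P = convexHull ℝ (Set.extremePoints ℝ P)) :
    ∃ v, VData P v := by
  obtain ⟨f, hf, hfE, hfall⟩ := exists_sorted hc h0 hsym hfin hcard
  have hneg : ∀ x ∈ Set.extremePoints ℝ P, -x ∈ Set.extremePoints ℝ P := by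
    intro x hx
    refine ⟨hsym x hx.1, ?_⟩
    intro a ha b hb hab
    have := hx.2 (hsym a ha) (hsym b hb) (by
      obtain ⟨p, q, hp, hq, hpq, h⟩ := hab
      refine ⟨p, q, hp, hq, hpq, ?_⟩
      rw [smul_neg, smul_neg, ← neg_add, h, neg_neg])
    rw [← this, neg_neg]
  set v := vseq f with hv
  have per : ∀ n, v (n + 7) = - v n := vseq_add f
  have ext : ∀ n, v n ∈ Set.extremePoints ℝ P := by
    intro n
    rw [hv]
    unfold vseq
    rcases neg_one_pow_eq_or ℝ (n / 7) with h | h <;> rw [h]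
    · simpa using hfE _
    · simpa using hneg _ (hfE _)
  have pos : ∀ i j, i < j → j < i + 7 → 0 < dt (v i) (v j) := fun i j h1 h2 =>
    vseq_pos f hf h1 h2
  have per14 : ∀ n, v (n + 14) = v n := fun n => by
    rw [show n + 14 = (n + 7) + 7 by ring, per, per, neg_neg]
  have strict : ∀ i j, i + 2 ≤ j → j ≤ i + 13 →
      dt (v j) (v (i + 1) - v i) < dt (v i) (v (i + 1)) := by
    intro i j h1 h2
    have hab := pos i (i+1) (by omega) (by omega)
    rcases Nat.lt_or_ge j (i + 7) with h | h
    · exact strict_aux hc h0 (ext _) (ext _).1 (ext _).1 hab (pos _ _ (by omega) (by omega))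
        (pos _ _ (by omega) (by omega))
    · obtain ⟨m, rfl⟩ : ∃ m, j = m + 7 := ⟨j - 7, by omega⟩
      rcases Nat.lt_or_ge m (i + 2) with h3 | h3
      · rw [per]
        rcases (by omega : m = i ∨ m = i + 1) with rfl | rfl
        · rw [dt_neg_left, dt_seg (left_mem_segment _ _ _)]; linarith
        · rw [dt_neg_left, dt_seg (right_mem_segment _ _ _)]; linarith
      · refine strict_aux' hc h0 (ext _) (ext _).1 (ext _).1 hab ?_ ?_
        · rw [← per14 i]; exact pos _ _ (by omega) (by omega)
        · rw [← per14 (i+1)]; exact pos _ _ (by omega) (by omega)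
  refine ⟨v, per, fun n => (ext n).1, pos, strict, ?_⟩
  intro i x hx
  set g : Pt → ℝ := fun x => dt x (v (i + 1) - v i) with hg
  have glin : ∀ (p q : ℝ) (x y : Pt), g (p • x + q • y) = p * g x + q * g y := by
    intro p q x y; simp [hg, dt]; ring
  set C : Set Pt := {x | g x < dt (v i) (v (i + 1)) ∨ x ∈ segment ℝ (v i) (v (i + 1))} with hC
  have hCle : ∀ x ∈ C, g x ≤ dt (v i) (v (i + 1)) := by
    rintro x (hx | hx)
    · exact hx.le
    · exact (dt_seg hx).le
  have hCc : Convex ℝ C := by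
    intro x hx y hy p q hp hq hpq
    rcases hp.eq_or_lt with hp0 | hp0
    · subst hp0; simp at hpq; subst hpq; simpa using hy
    rcases hq.eq_or_lt with hq0 | hq0
    · subst hq0; simp at hpq; subst hpq; simpa using hx
    have hx' := hCle x hx
    have hy' := hCle y hy
    have hq1 : q = 1 - p := by linarith
    rcases hx with hx | hx
    · left
      rw [glin, hq1]
      rw [hq1] at hq0
      nlinarith [mul_lt_mul_of_pos_left hx hp0, mul_le_mul_of_nonneg_left hy' hq0.le]
    rcases hy with hy | hy
    · left
      rw [glin, hq1]
      rw [hq1] at hq0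
      nlinarith [mul_le_mul_of_nonneg_left hx' hp0.le, mul_lt_mul_of_pos_left hy hq0]
    right
    exact convex_segment _ _ hx hy hp hq hpq
  have hEC : Set.extremePoints ℝ P ⊆ C := by
    intro u hu
    obtain ⟨m, rfl⟩ : ∃ m, u = v m := by
      obtain ⟨r, hr | hr⟩ := hfall u hu
      · refine ⟨r, ?_⟩
        rw [hr, hv]; unfold vseq
        rw [Nat.div_eq_of_lt r.2]
        simp [Nat.mod_eq_of_lt r.2]
      · refine ⟨r + 7, ?_⟩
        rw [per, hr, hv]; unfold vseq
        rw [Nat.div_eq_of_lt r.2]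
        simp [Nat.mod_eq_of_lt r.2]
    have perk : ∀ k n, v (n + 14 * k) = v n := by
      intro k n
      induction k with
      | zero => rfl
      | succ k ih => rw [show n + 14 * (k+1) = n + 14 * k + 14 by ring, per14, ih]
    obtain ⟨j, hj1, hj2, hj3⟩ : ∃ j, i ≤ j ∧ j ≤ i + 13 ∧ v m = v j := by
      refine ⟨i + (m + 14 * i - i) % 14, by omega, by omega, ?_⟩
      rw [← perk i m, ← perk ((m + 14 * i - i)/14) (i + (m + 14 * i - i) % 14)]
      congr 1
      omega
    rw [hj3]
    rcases Nat.lt_or_ge j (i + 2) with h3 | h3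
    · right
      rcases (by omega : j = i ∨ j = i + 1) with rfl | rfl
      · exact left_mem_segment _ _ _
      · exact right_mem_segment _ _ _
    · left
      exact strict i j h3 hj2
  rw [hhull] at hx
  exact convexHull_min hEC hCc hx

lemma VData.le {P : Set Pt} {v : ℕ → Pt} (h : VData P v) (i : ℕ) {x : Pt} (hx : x ∈ P) :
    dt x (v (i + 1) - v i) ≤ dt (v i) (v (i + 1)) := by
  rcases h.face i x hx with h | h
  · exact h.le
  · exact (dt_seg h).le

lemma VData.per14 {P : Set Pt} {v : ℕ → Pt} (h : VData P v) (n : ℕ) : v (n + 14) = v n := by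
  rw [show n + 14 = (n + 7) + 7 by ring, h.per, h.per, neg_neg]

/-- consecutive edges turn left, globally within half a turn -/
lemma VData.edge_pos {P : Set Pt} {v : ℕ → Pt} (h : VData P v) {i j : ℕ} (hij : i < j)
    (hj : j < i + 7) : 0 < dt (v (i + 1) - v i) (v (j + 1) - v j) := by
  set F : Pt → ℝ := fun x => dt x (v (j + 1) - v j) with hF
  set H := dt (v j) (v (j + 1)) with hH
  have hHpos : 0 < H := h.pos _ _ (by omega) (by omega)
  have hFc : F (v j) = H := dt_seg (left_mem_segment _ _ _)
  have hFd : F (v (j+1)) = H := dt_seg (right_mem_segment _ _ _)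
  have hlin : ∀ (a b u : Pt), dt a b * F u = dt u b * F a + dt a u * F b := by
    intro a b u
    simp only [hF, dt, Prod.fst_sub, Prod.snd_sub]; ring
  have hFa : F (v i) < H := by
    rw [← h.per14 i]; exact h.strict j (i + 14) (by omega) (by omega)
  have hFb : - H < F (v (i+1)) := by
    have := h.strict j (i + 1 + 7) (by omega) (by omega)
    rw [h.per, dt_neg_left] at this
    change - F (v (i+1)) < H at this
    linarith
  rw [dt_sub_left]
  change 0 < F (v (i+1)) - F (v i)
  have hβ : 0 < dt (v i) (v (i+1)) := h.pos _ _ (by omega) (by omega)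
  rcases le_or_gt 0 (F (v i)) with h1 | h1
  · have hD : 0 < dt (v i) (v j) := h.pos _ _ hij hj
    have hα : 0 ≤ dt (v (i+1)) (v j) := by
      rcases (by omega : i + 1 = j ∨ i + 1 < j) with hh | hh
      · rw [hh]; simp [dt, mul_comm]
      · exact (h.pos _ _ hh (by omega)).le
    have hl := hlin (v i) (v j) (v (i+1))
    rw [hFc] at hl
    have hB := h.le i (h.mem j)
    rw [dt_sub_right, dt_swap (v j) (v (i+1)), dt_swap (v j) (v i)] at hB
    generalize dt (v i) (v j) = D at *
    generalize dt (v (i+1)) (v j) = α at *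
    generalize dt (v i) (v (i+1)) = β at *
    generalize F (v i) = x at *
    generalize F (v (i+1)) = y at *
    have : 0 < D * (y - x) := by
      rcases le_or_gt D α with h2 | h2
      · nlinarith [mul_nonneg (sub_nonneg.2 h2) h1, mul_pos hβ hHpos]
      · nlinarith [mul_pos (sub_pos.2 h2) (sub_pos.2 hFa)]
    exact (pos_iff_pos_of_mul_pos this).1 hD
  rcases le_or_gt 0 (F (v (i+1))) with h2 | h2
  · linarith
  · have hc' : ∀ n, dt (-v (j+1)) (v n) = dt (v (j + 8)) (v (n + 14)) := by
      intro n
      rw [h.per14, show j + 8 = j + 1 + 7 by ring, h.per]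
    have hD : 0 < dt (-v (j+1)) (v (i+1)) := by
      rw [hc']; exact h.pos _ _ (by omega) (by omega)
    have hα : 0 ≤ dt (-v (j+1)) (v i) := by
      rw [hc']
      rcases (by omega : j + 8 = i + 14 ∨ j + 8 < i + 14) with hh | hh
      · rw [hh]; simp [dt, mul_comm]
      · exact (h.pos _ _ hh (by omega)).le
    have hl := hlin (-v (j+1)) (v (i+1)) (v i)
    have hFc' : F (-v (j+1)) = - H := by rw [← hFd]; simp only [hF, dt_neg_left]
    rw [hFc'] at hl
    have hB := h.le i (h.mem (j+1+7))
    rw [h.per, dt_sub_right] at hB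
    generalize dt (-v (j+1)) (v (i+1)) = D at *
    generalize dt (-v (j+1)) (v i) = α at *
    generalize dt (v i) (v (i+1)) = β at *
    generalize F (v i) = x at *
    generalize F (v (i+1)) = y at *
    have : 0 < D * (y - x) := by
      rcases le_or_gt D α with h3 | h3
      · nlinarith [mul_nonneg (sub_nonneg.2 h3) (neg_nonneg.2 h2.le), mul_pos hβ hHpos]
      · nlinarith [mul_pos (sub_pos.2 h3) (sub_pos.2 hFb)]
    exact (pos_iff_pos_of_mul_pos this).1 hD

lemma intLattice_countable : IntLattice.Countable := by
  have : IntLattice = Set.range (fun p : ℤ × ℤ => (((p.1 : ℝ), (p.2 : ℝ)) : Pt)) := by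
    ext p
    simp only [IntLattice, Set.mem_ofPred_eq, Set.mem_range, Prod.exists]
    constructor
    · rintro ⟨a, b, h⟩; exact ⟨a, b, h.symm⟩
    · rintro ⟨a, b, h⟩; exact ⟨a, b, h.symm⟩
  rw [this]
  exact Set.countable_range _

lemma intLattice_finite {S : Set Pt} (hS : Bornology.IsBounded S) :
    {l ∈ IntLattice | l ∈ S}.Finite := by
  obtain ⟨R, hR⟩ := hS.subset_closedBall 0
  have : {l ∈ IntLattice | l ∈ S} ⊆ (fun p : ℤ × ℤ => (((p.1 : ℝ), (p.2 : ℝ)) : Pt)) ''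
      ((Set.Icc (-⌈R⌉) ⌈R⌉) ×ˢ (Set.Icc (-⌈R⌉) ⌈R⌉)) := by
    rintro l ⟨⟨a, b, rfl⟩, hl⟩
    have h1 := hR hl
    rw [mem_closedBall_zero_iff, Prod.norm_def, max_le_iff] at h1
    simp only [Real.norm_eq_abs, abs_le] at h1
    obtain ⟨⟨h1, h2⟩, h3, h4⟩ := h1
    have hc := Int.le_ceil R
    refine ⟨(a, b), ⟨⟨?_, ?_⟩, ⟨?_, ?_⟩⟩, rfl⟩
    · have : (-(⌈R⌉:ℝ)) ≤ a := by linarith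
      exact_mod_cast this
    · have : (a:ℝ) ≤ ⌈R⌉ := by linarith
      exact_mod_cast this
    · have : (-(⌈R⌉:ℝ)) ≤ b := by linarith
      exact_mod_cast this
    · have : (b:ℝ) ≤ ⌈R⌉ := by linarith
      exact_mod_cast this
  exact (((Set.finite_Icc _ _).prod (Set.finite_Icc _ _)).image _).subset this

lemma finite_of_no_three {S : Set ℝ} (h : ∀ a ∈ S, ∀ b ∈ S, ∀ c ∈ S, a < b → b < c → False) :
    S.Finite := by
  by_contra hS
  obtain ⟨t, ht, hc⟩ := Set.Infinite.exists_subset_card_eq hS 3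
  have hm := (t.orderEmbOfFin hc).strictMono
  have hmem := fun i => ht (Finset.orderEmbOfFin_mem t hc i)
  exact h _ (hmem 0) _ (hmem 1) _ (hmem 2) (hm (by decide)) (hm (by decide))

/-- A boundary point in the middle of a chord lies on an edge parallel to the chord. -/
lemma middle_boundary {P : Set Pt} (hc : Convex ℝ P) (h0 : (0:Pt) ∈ interior P)
    {y e : Pt} {h : ℝ} (hlt : |dt y e| < h) {p q : Pt}
    (hp : p ∈ P) (hq : q ∈ P) (hpe : dt p e = h) (hqe : dt q e = - h)
    (hy : y ∉ interior P) {α β : ℝ} (hα : 0 < α) (hβ : 0 < β)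
    (h1 : y + α • e ∈ P) (h2 : y - β • e ∈ P) : False := by
  obtain ⟨g, hg⟩ := geometric_hahn_banach_open_point hc.interior isOpen_interior hy
  have hle : ∀ x ∈ P, g x ≤ g y := by
    intro x hx
    have hcl : x ∈ closure (interior P) := by
      rw [hc.closure_interior_eq_closure_of_nonempty_interior ⟨0, h0⟩]
      exact subset_closure hx
    have hcs : IsClosed {x | g x ≤ g y} := isClosed_le g.continuous continuous_const
    exact closure_minimal (fun x hx => (hg x hx).le) hcs hcl
  have hge : g e = 0 := by
    have a1 := hle _ h1
    have a2 := hle _ h2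
    simp only [map_add, map_sub, map_smul, smul_eq_mul] at a1 a2
    have b1 : α * g e ≤ 0 := by linarith
    have b2 : 0 ≤ β * g e := by linarith
    have c1 : g e ≤ 0 := by by_contra! hh; nlinarith
    have c2 : 0 ≤ g e := by by_contra! hh; nlinarith
    linarith
  have hcoord : ∀ x : Pt, g x = x.1 * g (1, 0) + x.2 * g (0, 1) := by
    intro x
    have : x = x.1 • ((1, 0) : Pt) + x.2 • ((0, 1) : Pt) := by ext <;> simp
    conv_lhs => rw [this]
    simp only [map_add, map_smul, smul_eq_mul]
  have hkey : ∀ a b : Pt, g a * dt b e = g b * dt a e := by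
    intro a b
    rw [hcoord] at hge
    rw [hcoord a, hcoord b]
    unfold dt
    linear_combination (a.2 * b.1 - a.1 * b.2) * hge
  have hgy : 0 < g y := by
    have := hg 0 h0
    simpa using this
  have k1 := hkey p y
  have k2 := hkey q y
  rw [hpe] at k1
  rw [hqe] at k2
  have l1 := hle p hp
  have l2 := hle q hq
  rw [abs_lt] at hlt
  have hh : 0 < h := by linarith
  rcases le_or_gt 0 (dt y e) with hd | hd
  · nlinarith [mul_le_mul_of_nonneg_right l1 hd]
  · nlinarith [mul_le_mul_of_nonneg_right l2 (neg_nonneg.2 hd.le)]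

lemma edge_lemma {P : Set Pt} (hc : Convex ℝ P) (hcpt : IsCompact P)
    (h0 : (0:Pt) ∈ interior P) (hsym : ∀ x ∈ P, -x ∈ P) {k : ℕ}
    (hcov : ∀ p : Pt, (k : ℕ∞) ≤ {l ∈ IntLattice | p - l ∈ P}.encard)
    (hpack : ∀ p : Pt, {l ∈ IntLattice | p - l ∈ interior P}.encard ≤ (k : ℕ∞))
    {a b : Pt} (ha : a ∈ P) (hb : b ∈ P) (hab : 0 < dt a b)
    (hface : ∀ x ∈ P, dt x (b - a) < dt a b ∨ x ∈ segment ℝ a b) :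
    ∃ l ∈ IntLattice, ∃ s : ℝ, 0 < s ∧ s < 1 ∧ l = (2:ℝ) • (a + s • (b - a)) := by
  set h := dt a b with hh
  have hle : ∀ x ∈ P, dt x (b - a) ≤ h := by
    intro x hx
    rcases hface x hx with h | h
    · exact h.le
    · exact (dt_seg h).le
  have hge : ∀ x ∈ P, - h ≤ dt x (b - a) := by
    intro x hx
    have := hle _ (hsym x hx)
    rw [dt_neg_left] at this
    linarith
  set X : ℝ → Pt := fun s => a + s • (b - a) with hX
  have hXd : ∀ s, dt (X s) (b - a) = h := by
    intro s; simp only [hX, hh, dt, Prod.fst_add, Prod.snd_add, Prod.fst_sub, Prod.snd_sub,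
      Prod.smul_fst, Prod.smul_snd, smul_eq_mul]; ring
  have hXP : ∀ s ∈ Set.Ioo (0:ℝ) 1, X s ∈ P := by
    intro s hs
    have := hc ha hb (a := 1 - s) (b := s) (by linarith [hs.2]) hs.1.le (by ring)
    convert this using 1
    simp only [hX]; ext <;> simp <;> ring
  -- it suffices to find one meeting
  by_contra hcon
  push Not at hcon
  have hno : ∀ s ∈ Set.Ioo (0:ℝ) 1, ∀ l ∈ IntLattice, X s - l ∈ P →
      dt (X s - l) (b - a) ≠ - h := by
    intro s hs l hl hP hd
    have hyP := hsym _ hP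
    have hyd : dt (-(X s - l)) (b - a) = h := by rw [dt_neg_left, hd, neg_neg]
    rcases hface _ hyP with h1 | h1
    · linarith
    obtain ⟨p, q, hp, hq, hpq, he⟩ := h1
    refine hcon l hl ((s + q) / 2) (by linarith [hs.1]) (by linarith [hs.2]) ?_
    have : l = X s + (p • a + q • b) := by rw [he]; abel
    rw [this]
    have : p = 1 - q := by linarith
    subst this
    simp only [hX]
    ext <;> simp <;> ring
  -- generic point
  set Z : Pt → Set ℝ := fun l => {s ∈ Set.Ioo (0:ℝ) 1 | X s - l ∈ P ∧ X s - l ∉ interior P ∧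
    |dt (X s - l) (b - a)| < h} with hZ
  have hZfin : ∀ l, (Z l).Finite := by
    intro l
    refine finite_of_no_three ?_
    rintro s1 ⟨-, p1, -, -⟩ s2 ⟨-, -, n2, d2⟩ s3 ⟨-, p3, -, -⟩ h12 h23
    refine middle_boundary hc h0 d2 ha (hsym a ha) (dt_seg (left_mem_segment _ _ _))
      (by rw [dt_neg_left, dt_seg (left_mem_segment _ _ _)]) n2 (sub_pos.2 h23) (sub_pos.2 h12)
      ?_ ?_
    · convert p3 using 1; simp only [hX]; ext <;> simp <;> ring
    · convert p1 using 1; simp only [hX]; ext <;> simp <;> ring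
  have hZc : (⋃ l ∈ IntLattice, Z l).Countable :=
    intLattice_countable.biUnion (fun l _ => (hZfin l).countable)
  have hunc : ¬ (Set.Ioo (0:ℝ) 1).Countable := by
    intro hco
    have := Cardinal.mk_Ioo_real (zero_lt_one (α := ℝ))
    rw [← Cardinal.le_aleph0_iff_set_countable, this] at hco
    exact absurd hco (not_le.2 Cardinal.aleph0_lt_continuum)
  obtain ⟨s, hs, hsZ⟩ : ∃ s ∈ Set.Ioo (0:ℝ) 1, s ∉ ⋃ l ∈ IntLattice, Z l := by
    by_contra! hsub
    exact hunc (hZc.mono hsub)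
  set x := X s with hx
  have hxP : x ∈ P := hXP s hs
  have hxd : dt x (b - a) = h := hXd s
  have hcase : ∀ l ∈ IntLattice, x - l ∈ P → x - l ∈ interior P ∨ dt (x - l) (b - a) = h := by
    intro l hl hP
    by_contra! hn
    apply hsZ
    simp only [Set.mem_iUnion]
    refine ⟨l, hl, hs, hP, hn.1, ?_⟩
    rw [abs_lt]
    exact ⟨lt_of_le_of_ne (hge _ hP) (Ne.symm (hno s hs l hl hP)), lt_of_le_of_ne (hle _ hP) hn.2⟩
  set S := {l ∈ IntLattice | x - l ∈ interior P} with hS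
  -- finite relevant lattice points
  have hbd : Bornology.IsBounded
      ((fun z : ℝ × Pt => (1 + z.1) • x - z.2) '' (Set.Icc (0:ℝ) 1 ×ˢ P)) :=
    ((isCompact_Icc.prod hcpt).image (by fun_prop)).isBounded
  have hFfin := intLattice_finite hbd
  set F := {l ∈ IntLattice | l ∈
    ((fun z : ℝ × Pt => (1 + z.1) • x - z.2) '' (Set.Icc (0:ℝ) 1 ×ˢ P))} with hF
  have hFmem : ∀ δ ∈ Set.Icc (0:ℝ) 1, ∀ l ∈ IntLattice, (1 + δ) • x - l ∈ P → l ∈ F := by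
    intro δ hδ l hl hP
    exact ⟨hl, ⟨(δ, (1 + δ) • x - l), ⟨hδ, hP⟩, by simp⟩⟩
  have hSF : S ⊆ F := by
    rintro l ⟨hl, hi⟩
    exact hFmem 0 (by simp) l hl (by simpa using interior_subset hi)
  have hSfin : S.Finite := hFfin.subset hSF
  have ht1 : ∀ l : Pt, Filter.Tendsto (fun δ : ℝ => (1 + δ) • x - l) (nhdsWithin 0 (Set.Ioi 0))
      (nhds (x - l)) := by
    intro l
    have : ContinuousAt (fun δ : ℝ => (1 + δ) • x - l) 0 := by fun_prop
    have h := this.tendsto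
    simp only [add_zero, one_smul] at h
    exact h.mono_left nhdsWithin_le_nhds
  have ht2 : ∀ l : Pt, Filter.Tendsto (fun δ : ℝ => (1 - δ) • x - l) (nhdsWithin 0 (Set.Ioi 0))
      (nhds (x - l)) := by
    intro l
    have : ContinuousAt (fun δ : ℝ => (1 - δ) • x - l) 0 := by fun_prop
    have h := this.tendsto
    simp only [sub_zero, one_smul] at h
    exact h.mono_left nhdsWithin_le_nhds
  have ev1 : ∀ᶠ δ in nhdsWithin (0:ℝ) (Set.Ioi 0), ∀ l ∈ F, (1 + δ) • x - l ∈ P → l ∈ S := by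
    rw [Filter.eventually_all_finite hFfin]
    intro l hl
    by_cases hP : x - l ∈ P
    · rcases hcase l hl.1 hP with hi | hd
      · exact Filter.Eventually.of_forall (fun δ _ => ⟨hl.1, hi⟩)
      · filter_upwards [self_mem_nhdsWithin] with δ hδ hm
        exfalso
        have := hle _ hm
        have e : dt ((1 + δ) • x - l) (b - a) = dt (x - l) (b - a) + δ * dt x (b - a) := by
          simp [dt]; ring
        rw [e, hd, hxd] at this
        have : 0 < δ * h := mul_pos hδ hab
        linarith
    · have hop : Pᶜ ∈ nhds (x - l) := hcpt.isClosed.isOpen_compl.mem_nhds hP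
      filter_upwards [(ht1 l).eventually hop] with δ hδ hm
      exact absurd hm hδ
  have ev2 : ∀ᶠ δ in nhdsWithin (0:ℝ) (Set.Ioi 0), ∀ l ∈ S, (1 - δ) • x - l ∈ interior P := by
    rw [Filter.eventually_all_finite hSfin]
    intro l hl
    exact (ht2 l).eventually (isOpen_interior.mem_nhds hl.2)
  have ev3 : ∀ᶠ δ in nhdsWithin (0:ℝ) (Set.Ioi 0), δ < 1 :=
    nhdsWithin_le_nhds (Iio_mem_nhds one_pos)
  obtain ⟨δ, ⟨⟨e1, e2⟩, e3⟩, e4⟩ := (((ev1.and ev2).and ev3).and self_mem_nhdsWithin).exists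
  have e4 : 0 < δ := e4
  have z0 : (0:Pt) ∈ IntLattice := ⟨0, 0, by ext <;> simp⟩
  have zS : (0:Pt) ∉ S := by
    rintro ⟨-, hi⟩
    rw [sub_zero] at hi
    have hi' := mem_interior_iff_mem_nhds.1 hi
    have ht := ht1 0
    rw [sub_zero] at ht
    obtain ⟨ε, h1, h2⟩ := ((ht.eventually hi').and self_mem_nhdsWithin).exists
    have := hle _ h1
    have e : dt ((1 + ε) • x - 0) (b - a) = dt x (b - a) + ε * dt x (b - a) := by
      simp [dt]; ring
    rw [e, hxd] at this
    have : 0 < ε * h := mul_pos h2 hab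
    linarith
  have c1 : (k : ℕ∞) ≤ S.encard := by
    refine (hcov ((1 + δ) • x)).trans (Set.encard_le_encard ?_)
    rintro l ⟨hl, hP⟩
    exact e1 l (hFmem δ ⟨e4.le, e3.le⟩ l hl hP) hP
  have c2 : S.encard + 1 ≤ (k : ℕ∞) := by
    rw [← Set.encard_insert_of_notMem zS]
    refine le_trans (Set.encard_le_encard ?_) (hpack ((1 - δ) • x))
    rintro l (rfl | hl)
    · refine ⟨z0, ?_⟩
      rw [sub_zero]
      exact smul_mem_int hc h0 hxP (by linarith) (by linarith)
    · exact ⟨hl.1, e2 l hl⟩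
  have c3 := (add_le_add_left c1 1).trans c2
  norm_cast at c3
  omega

open MeasureTheory in
lemma volume_le {U : Set Pt} (hU : MeasurableSet U) {k : ℕ}
    (hpack : ∀ p : Pt, {l ∈ IntLattice | p - l ∈ U}.encard ≤ (k : ℕ∞)) :
    volume U ≤ (k : ENNReal) := by
  set φ : ℤ × ℤ → Pt := fun n => ((n.1 : ℝ), (n.2 : ℝ)) with hφ
  have hφinj : Function.Injective φ := by
    intro a b h
    have h1 := congrArg Prod.fst h
    have h2 := congrArg Prod.snd h
    simp only [hφ, Int.cast_inj] at h1 h2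
    exact Prod.ext h1 h2
  set Q : Set Pt := Set.Ico (0:ℝ) 1 ×ˢ Set.Ico (0:ℝ) 1 with hQ
  have hQm : MeasurableSet Q := measurableSet_Ico.prod measurableSet_Ico
  have hQv : volume Q = 1 := by
    rw [hQ, Measure.volume_eq_prod, Measure.prod_prod]; simp
  have hsub : U ⊆ ⋃ n : ℤ × ℤ, (fun x => φ n + x) '' (((fun x => φ n + x) ⁻¹' U) ∩ Q) := by
    intro x hx
    simp only [Set.mem_iUnion]
    refine ⟨(⌊x.1⌋, ⌊x.2⌋), (Int.fract x.1, Int.fract x.2), ⟨?_, ?_⟩, ?_⟩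
    · simpa [hφ] using hx
    · exact ⟨⟨Int.fract_nonneg _, Int.fract_lt_one _⟩, ⟨Int.fract_nonneg _, Int.fract_lt_one _⟩⟩
    · simp [hφ]
  calc volume U ≤ volume (⋃ n : ℤ × ℤ, (fun x => φ n + x) '' (((fun x => φ n + x) ⁻¹' U) ∩ Q)) :=
        measure_mono hsub
    _ ≤ ∑' n : ℤ × ℤ, volume ((fun x => φ n + x) '' (((fun x => φ n + x) ⁻¹' U) ∩ Q)) :=
        measure_iUnion_le _
    _ = ∑' n : ℤ × ℤ, volume (((fun x => φ n + x) ⁻¹' U) ∩ Q) := by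
        congr 1; ext n
        rw [Set.image_add_left, measure_preimage_add]
    _ = ∑' n : ℤ × ℤ, ∫⁻ x in Q, ((fun x => φ n + x) ⁻¹' U).indicator 1 x := by
        congr 1; ext n
        have hm : MeasurableSet ((fun x => φ n + x) ⁻¹' U) := (measurable_const_add _) hU
        rw [lintegral_indicator_one hm, Measure.restrict_apply hm]
    _ = ∫⁻ x in Q, ∑' n : ℤ × ℤ, ((fun x => φ n + x) ⁻¹' U).indicator 1 x := by
        rw [lintegral_tsum]
        intro n
        have hm : MeasurableSet ((fun x => φ n + x) ⁻¹' U) := (measurable_const_add _) hU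
        exact (measurable_one.indicator hm).aemeasurable
    _ ≤ ∫⁻ x in Q, (k : ENNReal) := by
        refine lintegral_mono (fun x => ?_)
        have h1 : ∑' n : ℤ × ℤ, ((fun x => φ n + x) ⁻¹' U).indicator (1 : Pt → ENNReal) x
            = ∑' n : ℤ × ℤ, ({n | φ n + x ∈ U} : Set (ℤ × ℤ)).indicator (fun _ => (1:ENNReal)) n := by
          congr 1
        show ∑' n : ℤ × ℤ, ((fun x => φ n + x) ⁻¹' U).indicator (1 : Pt → ENNReal) x ≤ _
        rw [h1, ← tsum_subtype, ENNReal.tsum_set_one]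
        have h2 : ({n | φ n + x ∈ U} : Set (ℤ × ℤ)).encard ≤ (k : ℕ∞) := by
          refine le_trans ?_ (hpack x)
          have hinj : Function.Injective (fun n => - φ n) := neg_injective.comp hφinj
          rw [← hinj.encard_image]
          apply Set.encard_le_encard
          rintro _ ⟨n, hn, rfl⟩
          refine ⟨⟨-n.1, -n.2, by simp [hφ]⟩, ?_⟩
          have hn : φ n + x ∈ U := hn
          simpa [add_comm] using hn
        calc _ ≤ (((k:ℕ∞)) : ENNReal) := by exact_mod_cast h2
          _ = k := by simp
    _ = k := by simp [hQv]

/-- the open triangle with vertices `0, a, b` -/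
def otri (a b : Pt) : Set Pt := {x | ∃ s r : ℝ, 0 < s ∧ 0 < r ∧ s + r < 1 ∧ x = s • a + r • b}

def stdtri : Set Pt := regionBetween (fun _ => (0:ℝ)) (fun x => 1 - x) (Set.Ioo (0:ℝ) 1)

open MeasureTheory in
lemma volume_stdtri : volume stdtri = ENNReal.ofReal (1/2) := by
  unfold stdtri
  rw [Measure.volume_eq_prod, volume_regionBetween_eq_integral]
  · congr 1
    rw [← integral_Ioc_eq_integral_Ioo, ← intervalIntegral.integral_of_le (by norm_num)]
    simp only [Pi.sub_apply, sub_zero]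
    rw [intervalIntegral.integral_sub (by simp) (by simp)]
    simp; norm_num
  · exact integrableOn_const (by simp)
  · exact (Continuous.integrableOn_Icc (by fun_prop)).mono_set Set.Ioo_subset_Icc_self
  · exact measurableSet_Ioo
  · intro x hx; simpa using hx.2.le

/-- linear map with prescribed columns -/
def colmap (a b : Pt) : Pt →ₗ[ℝ] Pt :=
  (LinearMap.fst ℝ ℝ ℝ).smulRight a + (LinearMap.snd ℝ ℝ ℝ).smulRight b

lemma colmap_apply (a b x : Pt) : colmap a b x = x.1 • a + x.2 • b := by
  simp [colmap]

lemma colmap_det (a b : Pt) : LinearMap.det (colmap a b) = dt a b := by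
  rw [← LinearMap.det_toMatrix (Module.Basis.finTwoProd ℝ), Matrix.det_fin_two]
  simp [LinearMap.toMatrix_apply, colmap_apply, dt]
  ring

open MeasureTheory in
lemma volume_otri (a b : Pt) (h : 0 < dt a b) :
    volume (otri a b) = ENNReal.ofReal (dt a b / 2) ∧ MeasurableSet (otri a b) := by
  have himg : otri a b = colmap a b '' stdtri := by
    ext x
    simp only [otri, stdtri, regionBetween, Set.mem_ofPred_eq, Set.mem_image, Prod.exists]
    constructor
    · rintro ⟨s, r, hs, hr, hsr, rfl⟩
      exact ⟨s, r, ⟨⟨hs, by linarith⟩, hr, by show r < 1 - s; linarith⟩, by simp [colmap_apply]⟩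
    · rintro ⟨s, r, ⟨⟨h1, h2⟩, h3, h4⟩, rfl⟩
      exact ⟨s, r, h1, h3, by have h4 : r < 1 - s := h4; linarith, by simp [colmap_apply]⟩
  have hm : MeasurableSet stdtri := measurableSet_regionBetween measurable_const
    (by fun_prop) measurableSet_Ioo
  constructor
  · rw [himg, Measure.addHaar_image_linearMap, colmap_det, volume_stdtri, abs_of_pos h,
      ← ENNReal.ofReal_mul h.le]
    congr 1; ring
  · rw [himg]
    have hdet : LinearMap.det (colmap a b) ≠ 0 := by rw [colmap_det]; exact h.ne'
    have hinj : Function.Injective (colmap a b) :=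
      (LinearMap.equivOfDetNeZero _ hdet).injective
    exact hm.image_of_continuousOn_injOn
      (LinearMap.continuous_of_finiteDimensional _).continuousOn hinj.injOn

open MeasureTheory in
lemma volume_ge {U : Set Pt} (m : ℕ → Pt) (hper : ∀ n, m (n + 7) = - m n)
    (hnn : ∀ i j, i ≤ j → j ≤ i + 7 → 0 ≤ dt (m i) (m j))
    (hpos : ∀ i, 0 < dt (m i) (m (i + 1)))
    (hsub : ∀ i, otri (m i) (m (i + 1)) ⊆ U) :
    ENNReal.ofReal (∑ i ∈ Finset.range 7, dt (m i) (m (i + 1))) ≤ volume U := by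
  have hdis : ∀ i j, i < j → j < 14 → Disjoint (otri (m i) (m (i + 1))) (otri (m j) (m (j + 1))) := by
    intro i j hij hj
    rw [Set.disjoint_left]
    rintro x ⟨s, r, hs, hr, -, rfl⟩ ⟨s', r', hs', hr', -, he⟩
    have hexp : ∀ z a b : Pt, ∀ p q : ℝ, dt z (p • a + q • b) = p * dt z a + q * dt z b := by
      intro z a b p q; simp [dt]; ring
    have hself : ∀ z : Pt, dt z z = 0 := by intro z; simp [dt, mul_comm]
    have hp := hpos i
    rcases Nat.lt_or_ge j (i + 7) with h | h
    · have := congrArg (dt (m (i+1))) he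
      rw [hexp, hexp, hself, dt_swap] at this
      have h1 := hnn (i+1) j (by omega) (by omega)
      have h2 := hnn (i+1) (j+1) (by omega) (by omega)
      have h3 : 0 < s * dt (m i) (m (i+1)) := mul_pos hs hp
      have h4 : 0 ≤ s' * dt (m (i+1)) (m j) := by positivity
      have h5 : 0 ≤ r' * dt (m (i+1)) (m (j+1)) := by positivity
      linarith
    · obtain ⟨n, rfl⟩ : ∃ n, j = n + 7 := ⟨j - 7, by omega⟩
      have := congrArg (dt (m i)) he
      rw [hexp, hexp, hself, hper, show n + 7 + 1 = n + 1 + 7 by ring, hper, dt_neg_right,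
        dt_neg_right] at this
      have h1 := hnn i n (by omega) (by omega)
      have h2 := hnn i (n+1) (by omega) (by omega)
      have h3 : 0 < r * dt (m i) (m (i+1)) := mul_pos hr hp
      have h4 : 0 ≤ s' * dt (m i) (m n) := by positivity
      have h5 : 0 ≤ r' * dt (m i) (m (n+1)) := by positivity
      linarith
  have hpd : Set.PairwiseDisjoint (↑(Finset.range 14)) (fun i => otri (m i) (m (i + 1))) := by
    intro i hi j hj hij
    simp only [Finset.coe_range, Set.mem_Iio] at hi hj
    rcases lt_or_gt_of_ne hij with h | h
    · exact hdis i j h hj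
    · exact (hdis j i h hi).symm
  have hvol := measure_biUnion_finset (μ := volume) hpd
    (fun i _ => (volume_otri _ _ (hpos i)).2)
  have hU : volume (⋃ i ∈ Finset.range 14, otri (m i) (m (i + 1))) ≤ volume U :=
    measure_mono (by simpa using fun i _ => hsub i)
  rw [hvol] at hU
  refine le_trans (le_of_eq ?_) hU
  rw [Finset.sum_congr rfl (fun i _ => (volume_otri _ _ (hpos i)).1),
    ← ENNReal.ofReal_sum_of_nonneg (fun i _ => by have := hpos i; positivity)]
  congr 1
  have hs : ∀ n, dt (m (n + 7)) (m (n + 7 + 1)) = dt (m n) (m (n + 1)) := by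
    intro n
    rw [hper, show n + 7 + 1 = n + 1 + 7 by ring, hper, dt_neg_left, dt_neg_right, neg_neg]
  rw [show 14 = 7 + 7 by rfl, Finset.sum_range_add]
  simp_rw [add_comm 7 _, hs]
  rw [← Finset.sum_add_distrib]
  refine Finset.sum_congr rfl (fun i _ => by ring)

/-- integer determinant -/
def idt (x y : ℤ × ℤ) : ℤ := x.1 * y.2 - x.2 * y.1

/-- By the Plücker relation, four plane vectors cannot have all six determinants equal to `1`. -/
lemma four_vec (a b c d : ℤ × ℤ) (h1 : 0 < idt a b) (h2 : 0 < idt a c) (h3 : 0 < idt a d)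
    (h4 : 0 < idt b c) (h5 : 0 < idt b d) (h6 : 0 < idt c d) :
    7 ≤ idt a b + idt a c + idt a d + idt b c + idt b d + idt c d := by
  by_contra! h
  have pl : idt a b * idt c d - idt a c * idt b d + idt a d * idt b c = 0 := by
    unfold idt; ring
  have e1 : idt a b = 1 := by omega
  have e2 : idt a c = 1 := by omega
  have e3 : idt a d = 1 := by omega
  have e4 : idt b c = 1 := by omega
  have e5 : idt b d = 1 := by omega
  have e6 : idt c d = 1 := by omega
  rw [e1, e2, e3, e4, e5, e6] at pl
  norm_num at pl

/-- Sum of all determinants of seven vectors, via the complements of the lines of the Fano plane. -/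
lemma seven_vec (w : ℕ → ℤ × ℤ) (h : ∀ i j, i < j → j < 7 → 0 < idt (w i) (w j)) :
    25 ≤ (idt (w 0) (w 1) + idt (w 0) (w 2) + idt (w 0) (w 3) + idt (w 0) (w 4) + idt (w 0) (w 5)
      + idt (w 0) (w 6)) + (idt (w 1) (w 2) + idt (w 1) (w 3) + idt (w 1) (w 4) + idt (w 1) (w 5)
      + idt (w 1) (w 6)) + (idt (w 2) (w 3) + idt (w 2) (w 4) + idt (w 2) (w 5) + idt (w 2) (w 6))
      + (idt (w 3) (w 4) + idt (w 3) (w 5) + idt (w 3) (w 6)) + (idt (w 4) (w 5) + idt (w 4) (w 6))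
      + idt (w 5) (w 6) := by
  have f : ∀ i j k l, i < j → j < k → k < l → l < 7 →
      7 ≤ idt (w i) (w j) + idt (w i) (w k) + idt (w i) (w l) + idt (w j) (w k)
        + idt (w j) (w l) + idt (w k) (w l) := by
    intro i j k l h1 h2 h3 h4
    exact four_vec _ _ _ _ (h _ _ (by omega) (by omega)) (h _ _ (by omega) (by omega))
      (h _ _ (by omega) (by omega)) (h _ _ (by omega) (by omega)) (h _ _ (by omega) (by omega))
      (h _ _ (by omega) (by omega))
  -- lines of the Fano plane: {i, i+1, i+3} mod 7
  have b0 := f 2 4 5 6 (by omega) (by omega) (by omega) (by omega)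
  have b1 := f 0 3 5 6 (by omega) (by omega) (by omega) (by omega)
  have b2 := f 0 1 4 6 (by omega) (by omega) (by omega) (by omega)
  have b3 := f 0 1 2 5 (by omega) (by omega) (by omega) (by omega)
  have b4 := f 1 2 3 6 (by omega) (by omega) (by omega) (by omega)
  have b5 := f 0 2 3 4 (by omega) (by omega) (by omega) (by omega)
  have b6 := f 1 3 4 5 (by omega) (by omega) (by omega) (by omega)
  omega

lemma core {P : Set Pt} (hc : Convex ℝ P) (hcpt : IsCompact P) (h0 : (0:Pt) ∈ interior P)
    (hsym : ∀ x ∈ P, -x ∈ P)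
    (hfin : (Set.extremePoints ℝ P).Finite) (hcard : (Set.extremePoints ℝ P).ncard = 14)
    (hhull : P = convexHull ℝ (Set.extremePoints ℝ P)) {k : ℕ} (hk : k ≤ 6)
    (hcov : ∀ p : Pt, (k : ℕ∞) ≤ {l ∈ IntLattice | p - l ∈ P}.encard)
    (hpack : ∀ p : Pt, {l ∈ IntLattice | p - l ∈ interior P}.encard ≤ (k : ℕ∞)) : False := by
  obtain ⟨v, hv⟩ := exists_vdata hc h0 hsym hfin hcard hhull
  have hedge : ∀ i, ∃ s : ℝ, ∃ t : ℤ × ℤ, 0 < s ∧ s < 1 ∧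
      (((t.1 : ℝ), (t.2 : ℝ)) : Pt) = (2:ℝ) • (v i + s • (v (i+1) - v i)) := by
    intro i
    obtain ⟨l, ⟨a, b, rfl⟩, s, h1, h2, h3⟩ := edge_lemma hc hcpt h0 hsym hcov hpack (hv.mem i)
      (hv.mem (i+1)) (hv.pos _ _ (by omega) (by omega)) (hv.face i)
    exact ⟨s, (a, b), h1, h2, h3⟩
  choose s' t' hs0' hs1' ht' using hedge
  set s : ℕ → ℝ := fun n => s' (n % 7) with hs
  have hs0 : ∀ n, 0 < s n := fun n => hs0' _
  have hs1 : ∀ n, s n < 1 := fun n => hs1' _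
  have hsp : ∀ n, s (n + 7) = s n := fun n => by simp [hs]
  set m : ℕ → Pt := fun n => v n + s n • (v (n+1) - v n) with hm
  have hmp : ∀ n, m (n + 7) = - m n := by
    intro n
    simp only [hm, hsp]
    rw [hv.per, show n + 7 + 1 = n + 1 + 7 by ring, hv.per]
    ext <;> simp <;> ring
  have hvnn : ∀ i j, i ≤ j → j ≤ i + 7 → 0 ≤ dt (v i) (v j) := by
    intro i j h1 h2
    rcases (by omega : i = j ∨ j = i + 7 ∨ (i < j ∧ j < i + 7)) with rfl | rfl | ⟨h3, h4⟩
    · simp [dt, mul_comm]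
    · rw [hv.per]; simp [dt, mul_comm]
    · exact (hv.pos _ _ h3 h4).le
  have henn : ∀ i j, i ≤ j → j ≤ i + 7 → 0 ≤ dt (v (i+1) - v i) (v (j+1) - v j) := by
    intro i j h1 h2
    rcases (by omega : i = j ∨ j = i + 7 ∨ (i < j ∧ j < i + 7)) with rfl | rfl | ⟨h3, h4⟩
    · simp [dt, mul_comm]
    · rw [show i + 7 + 1 = i + 1 + 7 by ring, hv.per, hv.per]
      apply le_of_eq
      simp [dt]; ring
    · exact (hv.edge_pos h3 h4).le
  have hmm : ∀ i j, dt (m i) (m j) = (1 - s i) * (1 - s j) * dt (v i) (v j)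
      + (1 - s i) * s j * dt (v i) (v (j+1)) + s i * (1 - s j) * dt (v (i+1)) (v j)
      + s i * s j * dt (v (i+1)) (v (j+1)) := by
    intro i j; simp [hm, dt]; ring
  have hmnn : ∀ i j, i ≤ j → j ≤ i + 7 → 0 ≤ dt (m i) (m j) := by
    intro i j h1 h2
    rcases (by omega : i = j ∨ j = i + 7 ∨ (i < j ∧ j < i + 7)) with rfl | rfl | ⟨h3, h4⟩
    · simp [dt, mul_comm]
    · rw [hmp]; simp [dt, mul_comm]
    · rw [hmm]
      have a1 := hvnn i j (by omega) (by omega)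
      have a2 := hvnn i (j+1) (by omega) (by omega)
      have a3 := hvnn (i+1) j (by omega) (by omega)
      have a4 := hvnn (i+1) (j+1) (by omega) (by omega)
      have := hs0 i
      have := hs0 j
      have := sub_pos.2 (hs1 i)
      have := sub_pos.2 (hs1 j)
      positivity
  have hmpos : ∀ i, 0 < dt (m i) (m (i+1)) := by
    intro i
    rw [hmm]
    have a1 := hv.pos i (i+1) (by omega) (by omega)
    have a2 := hvnn i (i+1+1) (by omega) (by omega)
    have a3 := hvnn (i+1) (i+1) (by omega) (by omega)
    have a4 := hvnn (i+1) (i+1+1) (by omega) (by omega)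
    have := hs0 i
    have := hs0 (i+1)
    have := sub_pos.2 (hs1 i)
    have := sub_pos.2 (hs1 (i+1))
    positivity
  have hwpos : ∀ i j, i < j → j < 7 → 0 < dt (m (i+1) - m i) (m (j+1) - m j) := by
    intro i j hij hj
    have hexp : dt (m (i+1) - m i) (m (j+1) - m j) =
        (1 - s i) * (1 - s j) * dt (v (i+1) - v i) (v (j+1) - v j)
        + (1 - s i) * s (j+1) * dt (v (i+1) - v i) (v (j+1+1) - v (j+1))
        + s (i+1) * (1 - s j) * dt (v (i+1+1) - v (i+1)) (v (j+1) - v j)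
        + s (i+1) * s (j+1) * dt (v (i+1+1) - v (i+1)) (v (j+1+1) - v (j+1)) := by
      simp [hm, dt]; ring
    rw [hexp]
    have a1 := hv.edge_pos (i := i) (j := j) (by omega) (by omega)
    have a2 := henn i (j+1) (by omega) (by omega)
    have a3 := henn (i+1) j (by omega) (by omega)
    have a4 := henn (i+1) (j+1) (by omega) (by omega)
    have := hs0 (i+1)
    have := hs0 (j+1)
    have := sub_pos.2 (hs1 i)
    have := sub_pos.2 (hs1 j)
    positivity
  have hmP : ∀ i, m i ∈ P := by
    intro i
    have := hc (hv.mem i) (hv.mem (i+1)) (a := 1 - s i) (b := s i) (by linarith [hs1 i])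
      (hs0 i).le (by ring)
    convert this using 1
    simp only [hm]; ext <;> simp <;> ring
  -- integer points
  have htex : ∀ i, i ≤ 7 → ∃ t : ℤ × ℤ, (((t.1 : ℝ), (t.2 : ℝ)) : Pt) = (2:ℝ) • m i := by
    intro i hi
    rcases (by omega : i < 7 ∨ i = 7) with h | rfl
    · refine ⟨t' i, ?_⟩
      rw [ht']
      simp only [hm, hs, Nat.mod_eq_of_lt h]
    · refine ⟨-t' 0, ?_⟩
      rw [show 7 = 0 + 7 by rfl, hmp, smul_neg]
      have := ht' 0
      simp only [hm, hs]
      rw [Nat.zero_mod, ← this]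
      simp
  choose! t ht using htex
  set w : ℕ → ℤ × ℤ := fun i => t (i+1) - t i with hw
  have hwdt : ∀ i j, i < 7 → j < 7 →
      ((idt (w i) (w j) : ℤ) : ℝ) = 4 * dt (m (i+1) - m i) (m (j+1) - m j) := by
    intro i j hi hj
    have q1 := ht i (by omega)
    have q2 := ht (i+1) (by omega)
    have q3 := ht j (by omega)
    have q4 := ht (j+1) (by omega)
    simp only [Prod.ext_iff, Prod.smul_fst, Prod.smul_snd, smul_eq_mul] at q1 q2 q3 q4
    simp only [idt, hw, dt, Prod.fst_sub, Prod.snd_sub]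
    push_cast
    rw [q1.1, q1.2, q2.1, q2.2, q3.1, q3.2, q4.1, q4.2]
    ring
  have h25 := seven_vec w (fun i j hij hj => by
    have h1 := hwdt i j (by omega) hj
    have h2 := hwpos i j hij hj
    have : (0:ℝ) < ((idt (w i) (w j) : ℤ) : ℝ) := by rw [h1]; linarith
    exact_mod_cast this)
  have h25r : (25:ℝ) ≤ 4 * ∑ i ∈ Finset.range 7, dt (m i) (m (i+1)) := by
    have h : ((25:ℤ):ℝ) ≤ _ := Int.cast_le.2 h25
    push_cast at h
    rw [hwdt 0 1, hwdt 0 2, hwdt 0 3, hwdt 0 4, hwdt 0 5, hwdt 0 6, hwdt 1 2, hwdt 1 3, hwdt 1 4,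
      hwdt 1 5, hwdt 1 6, hwdt 2 3, hwdt 2 4, hwdt 2 5, hwdt 2 6, hwdt 3 4, hwdt 3 5, hwdt 3 6,
      hwdt 4 5, hwdt 4 6, hwdt 5 6] at h <;> try omega
    refine h.trans (le_of_eq ?_)
    have h7 : m 7 = - m 0 := hmp 0
    simp only [Finset.sum_range_succ, Finset.sum_range_zero, Nat.reduceAdd, zero_add, h7, dt,
      Prod.fst_sub, Prod.snd_sub, Prod.fst_neg, Prod.snd_neg]
    ring
  have hge := volume_ge (U := interior P) m hmp hmnn hmpos (by
    rintro i x ⟨p, q, hp, hq, hpq, rfl⟩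
    exact combo_mem_int hc h0 (hmP _) (hmP _) hp.le hq.le hpq)
  have hle := volume_le isOpen_interior.measurableSet hpack
  have hfin := hge.trans hle
  rw [← ENNReal.ofReal_natCast, ENNReal.ofReal_le_ofReal_iff (by positivity)] at hfin
  have : (k:ℝ) ≤ 6 := by exact_mod_cast hk
  linarith

/-- a centrally symmetric convex tetradecagon admits no `k`-fold lattice tiling of
the plane for any positive `k ≤ 6`; that is, `τ*(P) ≥ 7`. -/
theorem tetradecagon_lattice_ge_seven (P : Set Pt) (hP : IsConvexPolygon P 14)
    (hsym : CentrallySymmetric P) :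
    ∀ (L : Set Pt) (k : ℕ), 0 < k → k ≤ 6 → ¬IsKFoldLatticeTiling P L k := by
  rintro L k - hk ⟨⟨B, rfl⟩, hcov, hpack⟩
  obtain ⟨hc, hcpt, hinter, hfin, hcard, -⟩ := hP
  obtain ⟨c, hcs⟩ := hsym
  -- normalisation `z ↦ B⁻¹ (z - c)`
  set A : Pt ≃L[ℝ] Pt := B.toContinuousLinearEquiv with hA
  have hAB : ∀ x, A x = B x := fun x => rfl
  let φ : Pt ≃ᵃ[ℝ] Pt := (A.toLinearEquiv.toAffineEquiv).trans (AffineEquiv.constVAdd ℝ Pt c)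
  let Φ : Pt ≃ₜ Pt := A.toHomeomorph.trans (Homeomorph.addLeft c)
  have hφΦ : ∀ x, φ x = c + A x := fun x => rfl
  have hΦ : ∀ x, Φ x = c + A x := fun x => rfl
  set R : Set Pt := Φ ⁻¹' P with hR
  have hRmem : ∀ x, x ∈ R ↔ c + A x ∈ P := fun x => Iff.rfl
  have hRint : ∀ x, x ∈ interior R ↔ c + A x ∈ interior P := by
    intro x
    rw [hR, ← Φ.preimage_interior]; rfl
  have hRc : Convex ℝ R := by
    have : R = (φ : Pt →ᵃ[ℝ] Pt) ⁻¹' P := by ext x; rfl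
    rw [this]
    exact hc.affine_preimage _
  have hRcpt : IsCompact R := by rw [hR]; exact Φ.isCompact_preimage.2 hcpt
  have hRsym : ∀ x ∈ R, -x ∈ R := by
    intro x hx
    rw [hRmem] at hx ⊢
    have := (hcs _).1 hx
    convert this using 1
    rw [map_neg]; abel
  have hR0 : (0:Pt) ∈ interior R := by
    obtain ⟨z, hz⟩ := hinter
    set y := Φ.symm z with hy
    have hyR : y ∈ interior R := by
      rw [hR, ← Φ.preimage_interior]
      simpa [hy] using hz
    have hny : -y ∈ R := hRsym y (interior_subset hyR)
    have := hRc.combo_interior_self_mem_interior hyR hny (a := 1/2) (b := 1/2) (by norm_num)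
      (by norm_num) (by norm_num)
    simpa using this
  have hext : Set.extremePoints ℝ R = Φ ⁻¹' (Set.extremePoints ℝ P) := by
    have hcombo : ∀ (p q : ℝ) (x y : Pt), p + q = 1 →
        Φ (p • x + q • y) = p • Φ x + q • Φ y := by
      intro p q x y hpq
      have : p = 1 - q := by linarith
      subst this
      simp only [hΦ, map_add, map_smul]
      ext <;> simp <;> ring
    ext x
    constructor
    · rintro ⟨hx, h⟩
      refine ⟨hx, ?_⟩
      intro a ha b hb hab
      obtain ⟨a, rfl⟩ := Φ.surjective a
      obtain ⟨b, rfl⟩ := Φ.surjective b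
      obtain ⟨p, q, hp, hq, hpq, he⟩ := hab
      rw [← hcombo p q a b hpq] at he
      rw [h ha hb ⟨p, q, hp, hq, hpq, Φ.injective he⟩]
    · rintro ⟨hx, h⟩
      refine ⟨hx, ?_⟩
      intro a ha b hb hab
      obtain ⟨p, q, hp, hq, hpq, he⟩ := hab
      exact Φ.injective (h (show Φ a ∈ P from ha) (show Φ b ∈ P from hb)
        ⟨p, q, hp, hq, hpq, by rw [← hcombo p q a b hpq, he]⟩)
  have hRfin : (Set.extremePoints ℝ R).Finite := by
    rw [hext]; exact hfin.preimage Φ.injective.injOn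
  have hRcard : (Set.extremePoints ℝ R).ncard = 14 := by
    rw [hext, ← hcard]
    exact Set.ncard_preimage_of_injective_subset_range Φ.injective
      (by rw [Φ.surjective.range_eq]; exact Set.subset_univ _)
  have hRhull : R = convexHull ℝ (Set.extremePoints ℝ R) := by
    have := closure_convexHull_extremePoints hRcpt hRc
    rw [(hRfin.isCompact_convexHull (𝕜 := ℝ)).isClosed.closure_eq] at this
    exact this.symm
  have himg : ∀ (p : Pt) (K K' : Set Pt), (∀ x, x ∈ K' ↔ c + A x ∈ K) →
      {l ∈ B '' IntLattice | (c + A p) - l ∈ K} = B '' {l ∈ IntLattice | p - l ∈ K'} := by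
    intro p K K' hK
    ext l
    constructor
    · rintro ⟨⟨l, hl, rfl⟩, h⟩
      refine ⟨l, ⟨hl, ?_⟩, rfl⟩
      rw [hK, map_sub, hAB l]
      convert h using 1; abel
    · rintro ⟨l, ⟨hl, h⟩, rfl⟩
      refine ⟨⟨l, hl, rfl⟩, ?_⟩
      rw [hK, map_sub, hAB l] at h
      convert h using 1; abel
  refine core hRc hRcpt hR0 hRsym hRfin hRcard hRhull hk ?_ ?_
  · intro p
    have := hcov (c + A p)
    rwa [himg p P R hRmem, B.injective.encard_image] at this
  · intro p
    have := hpack (c + A p)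
    rwa [himg p (interior P) (interior R) hRint, B.injective.encard_image] at this
end
end

section
/- Let P be a centrally symmetric convex polygon in ℝ² with exactly 12 vertices (a centrally symmetric convex dodecagon). Then for every lattice Λ ⊆ ℝ² and every positive integer k ≤ 6, P + Λ is not a k-fold lattice tiling of ℝ²; that is, τ*(P) ≥ 7. -/
open Set Pointwise

noncomputable section

/-- The planar cross product. -/
def cr (a b : Pt) : ℝ := a.1 * b.2 - a.2 * b.1

/-- A centrally symmetric convex dodecagon given by its vertices in cyclic order. -/
structure Dodec (v : ℕ → Pt) : Prop where
  anti : ∀ i, v (i + 6) = -v i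
  pos : ∀ i j, i < j → j < i + 6 → 0 < cr (v i) (v j)
  tri : ∀ i j l, i < j → j < l → l < i + 6 →
    cr (v i) (v l) < cr (v i) (v j) + cr (v j) (v l)

/-- Edge vectors. -/
def ed (v : ℕ → Pt) (i : ℕ) : Pt := v (i + 1) - v i

/-- The affine functional of the `i`-th facet. -/
def fg (v : ℕ → Pt) (i : ℕ) (x : Pt) : ℝ := cr (ed v i) (x - v i)

theorem Dodec.per {v : ℕ → Pt} (h : Dodec v) (i : ℕ) : v (i + 12) = v i := by
  have h1 := h.anti (i + 6)
  rw [h.anti i] at h1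
  simpa using h1

theorem Dodec.per_mul {v : ℕ → Pt} (h : Dodec v) (i q : ℕ) : v (i + 12 * q) = v i := by
  induction q with
  | zero => simp
  | succ q ih => rw [← ih, ← h.per (i + 12 * q)]; congr 1

theorem Dodec.exists_off {v : ℕ → Pt} (h : Dodec v) (i l : ℕ) :
    ∃ d, d < 12 ∧ v l = v (i + d) := by
  refine ⟨(l + 11 * i) % 12, Nat.mod_lt _ (by norm_num), ?_⟩
  rw [← h.per_mul l i, ← h.per_mul (i + _) ((l + 11 * i) / 12)]
  congr 1
  omega

theorem Dodec.ed_anti {v : ℕ → Pt} (h : Dodec v) (i : ℕ) : ed v (i + 6) = -ed v i := by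
  unfold ed
  rw [h.anti i, show i + 6 + 1 = (i + 1) + 6 by ring, h.anti (i + 1)]
  abel

theorem fg_self (v : ℕ → Pt) (i : ℕ) : fg v i (v i) = 0 := by simp [fg, cr]

theorem fg_succ (v : ℕ → Pt) (i : ℕ) : fg v i (v (i + 1)) = 0 := by
  simp [fg, cr, ed]; ring

theorem Dodec.fg_pos {v : ℕ → Pt} (h : Dodec v) (i d : ℕ) (h2 : 2 ≤ d) (h12 : d < 12) :
    0 < fg v i (v (i + d)) := by
  have h01 := h.pos i (i + 1) (by omega) (by omega)
  rcases lt_or_ge d 6 with hd | hd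
  · have := h.tri i (i + 1) (i + d) (by omega) (by omega) (by omega)
    simp only [fg, cr, ed, Prod.fst_sub, Prod.snd_sub] at *
    linarith
  · obtain ⟨c, rfl⟩ := Nat.exists_eq_add_of_le hd
    rw [show i + (6 + c) = (i + c) + 6 by ring, h.anti]
    rcases Nat.lt_or_ge c 2 with hc | hc
    · interval_cases c
      · simp only [fg, cr, ed, Prod.fst_sub, Prod.snd_sub, Prod.fst_neg, Prod.snd_neg,
          add_zero] at *
        linarith
      · simp only [fg, cr, ed, Prod.fst_sub, Prod.snd_sub, Prod.fst_neg, Prod.snd_neg] at *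
        linarith
    · have := h.tri (i + c) (i + 6) (i + 1 + 6) (by omega) (by omega) (by omega)
      rw [h.anti, h.anti] at this
      simp only [fg, cr, ed, Prod.fst_sub, Prod.snd_sub, Prod.fst_neg, Prod.snd_neg] at *
      linarith

theorem Dodec.fg_nonneg {v : ℕ → Pt} (h : Dodec v) (i l : ℕ) : 0 ≤ fg v i (v l) := by
  obtain ⟨d, hd, e⟩ := h.exists_off i l
  rw [e]
  rcases Nat.lt_or_ge d 2 with hc | hc
  · interval_cases d
    · rw [add_zero, fg_self]
    · rw [fg_succ]
  · exact (h.fg_pos i d hc hd).le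

theorem Dodec.ed_pos {v : ℕ → Pt} (h : Dodec v) (i j : ℕ) (hij : i < j) (hj : j < i + 6) :
    0 < cr (ed v i) (ed v j) := by
  rcases Nat.eq_or_lt_of_le (Nat.succ_le_of_lt hij) with he | he
  · subst he
    have := h.fg_pos i 2 le_rfl (by norm_num)
    simp only [fg, cr, ed, Prod.fst_sub, Prod.snd_sub, Nat.succ_eq_add_one, add_assoc,
      Nat.reduceAdd] at *
    linarith
  · obtain ⟨d, rfl⟩ := Nat.exists_eq_add_of_le hij.le
    have hA := h.pos i (i + 1) (by omega) (by omega)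
    have hC := h.pos (i + d) (i + d + 1) (by omega) (by omega)
    have hbc := h.pos (i + 1) (i + d) (by omega) (by omega)
    have h1 := h.fg_pos i d (by omega) (by omega)
    have h2 := h.fg_pos i (d + 6) (by omega) (by omega)
    have h3 := h.fg_nonneg (i + d) (i + 1)
    have h4 := h.fg_nonneg (i + d) (i + 1 + 6)
    rw [show i + (d + 6) = i + d + 6 by ring, h.anti] at h2
    rw [h.anti] at h4
    set a := v i
    set b := v (i + 1)
    set c := v (i + d)
    set f := ed v (i + d) with hf
    set e := ed v i with he
    have hid : cr e f * cr b c = cr e b * cr f c - cr f b * cr e c := by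
      simp only [cr]; ring
    have e1 : cr e b = - cr a b := by simp [he, ed, cr]; ring
    have e2 : cr f c = - cr c (v (i + d + 1)) := by simp [hf, ed, cr]; ring
    set A := cr a b
    set C := cr c (v (i + d + 1))
    have i1 : -A < cr e c := by
      have : fg v i c = cr e c + A := by simp [fg, A, he, ed, cr, a, b]; ring
      linarith
    have i2 : cr e c < A := by
      have : fg v i (-c) = - cr e c + A := by simp [fg, A, he, ed, cr, a, b]; ring
      linarith
    have i3 : -C ≤ cr f b := by
      have : fg v (i + d) b = cr f b + C := by simp [fg, C, hf, ed, cr, c]; ring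
      linarith
    have i4 : cr f b ≤ C := by
      have : fg v (i + d) (-b) = -cr f b + C := by simp [fg, C, hf, ed, cr, c]; ring
      linarith
    have : 0 < cr e f * cr b c := by
      rw [hid, e1, e2]
      have : cr f b * cr e c < A * C := by
        rcases le_total 0 (cr e c) with hh | hh <;> nlinarith
      linarith
    exact pos_of_mul_pos_left this hbc.le

theorem Dodec.fg_per {v : ℕ → Pt} (h : Dodec v) (i l : ℕ) (x : Pt) :
    ∃ d, d < 12 ∧ fg v l x = fg v (i + d) x := by
  refine ⟨(l + 11 * i) % 12, Nat.mod_lt _ (by norm_num), ?_⟩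
  have e1 := h.per_mul l i
  have e2 := h.per_mul (i + (l + 11 * i) % 12) ((l + 11 * i) / 12)
  have e3 := h.per_mul (l + 1) i
  have e4 := h.per_mul (i + (l + 11 * i) % 12 + 1) ((l + 11 * i) / 12)
  unfold fg ed
  rw [← e1, ← e2, ← e3, ← e4]
  have a1 : i + (l + 11 * i) % 12 + 12 * ((l + 11 * i) / 12) = l + 12 * i := by omega
  have a2 : i + (l + 11 * i) % 12 + 1 + 12 * ((l + 11 * i) / 12) = l + 1 + 12 * i := by omega
  rw [a1, a2]

theorem Dodec.facet {v : ℕ → Pt} (h : Dodec v) {x : Pt} (hx : x ∈ convexHull ℝ (range v))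
    (i : ℕ) : 0 ≤ fg v i x := by
  have hc : Convex ℝ {x : Pt | 0 ≤ fg v i x} := by
    intro x hx y hy a b ha hb hab
    simp only [mem_ofPred_eq] at *
    have : fg v i (a • x + b • y) = a * fg v i x + b * fg v i y := by
      have hb' : b = 1 - a := by linarith
      subst hb'
      simp [fg, cr]; ring
    rw [this]; positivity
  refine convexHull_min ?_ hc hx
  rintro _ ⟨l, rfl⟩
  exact h.fg_nonneg i l

theorem Dodec.neg_mem {v : ℕ → Pt} (h : Dodec v) (i : ℕ) : -v i ∈ convexHull ℝ (range v) := by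
  rw [← h.anti]; exact subset_convexHull _ _ ⟨_, rfl⟩

theorem Dodec.zero_mem {v : ℕ → Pt} (h : Dodec v) : (0 : Pt) ∈ convexHull ℝ (range v) := by
  have := (convex_convexHull ℝ (range v)) (subset_convexHull _ _ ⟨0, rfl⟩) (h.neg_mem 0)
    (a := 1/2) (b := 1/2) (by norm_num) (by norm_num) (by norm_num)
  simpa using this

theorem Dodec.cone_mem {v : ℕ → Pt} (h : Dodec v) (i : ℕ) (s t : ℝ) (hs : 0 ≤ s) (ht : 0 ≤ t)
    (hst : s + t ≤ 1) : s • v i + t • v (i + 1) ∈ convexHull ℝ (range v) := by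
  have hc := convex_convexHull ℝ (range v)
  have := hc.sum_mem (t := Finset.univ) (w := ![s, t, 1 - s - t])
    (z := ![v i, v (i + 1), 0]) (by
      intro j _; fin_cases j <;> simp <;> linarith) (by simp [Fin.sum_univ_three]) (by
      intro j _
      fin_cases j
      · exact subset_convexHull _ _ ⟨_, rfl⟩
      · exact subset_convexHull _ _ ⟨_, rfl⟩
      · exact h.zero_mem)
  simpa [Fin.sum_univ_three] using this

/-- The closed cones cover the plane. -/
theorem Dodec.cone_cover {v : ℕ → Pt} (h : Dodec v) (x : Pt) :
    ∃ i, 0 ≤ cr (v i) x ∧ cr (v (i + 1)) x ≤ 0 := by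
  have key : ∀ i, 0 ≤ cr (v i) x → ∃ i, 0 ≤ cr (v i) x ∧ cr (v (i + 1)) x ≤ 0 := by
    intro i hi
    by_contra! hcon
    have all : ∀ m, 0 < cr (v (i + 1 + m)) x := by
      intro m
      induction m with
      | zero => exact hcon i hi
      | succ m ih => exact hcon _ ih.le
    have h1 := all 0
    have h2 := all 6
    rw [h.anti] at h2
    simp [cr] at h1 h2
    linarith
  rcases le_total 0 (cr (v 0) x) with h0 | h0
  · exact key 0 h0
  · refine key (0 + 6) ?_
    rw [h.anti]
    simp [cr] at *
    linarith

theorem Dodec.mem_of_facets {v : ℕ → Pt} (h : Dodec v) {x : Pt} (hx : ∀ i, 0 ≤ fg v i x) :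
    x ∈ convexHull ℝ (range v) := by
  obtain ⟨i, h1, h2⟩ := h.cone_cover x
  have hD := h.pos i (i + 1) (by omega) (by omega)
  set D := cr (v i) (v (i + 1)) with hDd
  have hx' : x = (-cr (v (i + 1)) x / D) • v i + (cr (v i) x / D) • v (i + 1) := by
    have hne := hD.ne'
    ext
    · simp only [Prod.fst_add, Prod.smul_fst, smul_eq_mul]
      field_simp
      rw [hDd]; simp only [cr]; ring
    · simp only [Prod.snd_add, Prod.smul_snd, smul_eq_mul]
      field_simp
      rw [hDd]; simp only [cr]; ring
  rw [hx']
  apply h.cone_mem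
  · apply div_nonneg _ hD.le; linarith
  · exact div_nonneg h1 hD.le
  · rw [← add_div, div_le_one hD]
    have := hx i
    have e : fg v i x = D - (-cr (v (i + 1)) x + cr (v i) x) := by
      rw [hDd]; simp [fg, ed, cr]; ring
    linarith

theorem fg_continuous (v : ℕ → Pt) (i : ℕ) : Continuous (fg v i) := by
  unfold fg cr; fun_prop

theorem Dodec.mem_int {v : ℕ → Pt} (h : Dodec v) {x : Pt}
    (hx : ∀ i < 12, 0 < fg v i x) : x ∈ interior (convexHull ℝ (range v)) := by
  have ho : IsOpen (⋂ i ∈ Finset.range 12, {x : Pt | 0 < fg v i x}) :=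
    isOpen_biInter_finset fun i _ => isOpen_lt continuous_const (fg_continuous v i)
  refine mem_interior.2 ⟨_, ?_, ho, ?_⟩
  · intro y hy
    apply h.mem_of_facets
    intro i
    obtain ⟨d, hd, e⟩ := h.fg_per 0 i y
    rw [e, zero_add]
    have := mem_iInter₂.1 hy d (by simpa using hd)
    exact le_of_lt this
  · exact mem_iInter₂.2 fun i hi => hx i (by simpa using hi)

section
open Filter Topology

/-- Lexicographic positivity of a facet functional at the germ `z + 0⁺ u + 0⁺⁺ w`. -/
def LexPos (v : ℕ → Pt) (z u w : Pt) (i : ℕ) : Prop :=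
  0 < fg v i z ∨ (fg v i z = 0 ∧
    (0 < cr (ed v i) u ∨ (cr (ed v i) u = 0 ∧ 0 < cr (ed v i) w)))

theorem fg_shift (v : ℕ → Pt) (i : ℕ) (z u w : Pt) (ε δ : ℝ) :
    fg v i (z + ε • u + δ • w) = fg v i z + ε * cr (ed v i) u + δ * cr (ed v i) w := by
  simp [fg, cr]; ring

theorem ev_small (c d : ℝ) (hc : 0 < c) : ∀ᶠ ε in 𝓝[>] (0 : ℝ), 0 < c + ε * d := by
  have : Tendsto (fun ε : ℝ => c + ε * d) (𝓝 0) (𝓝 (c + 0 * d)) :=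
    Continuous.tendsto (by fun_prop) 0
  rw [zero_mul, add_zero] at this
  exact (this.mono_left nhdsWithin_le_nhds).eventually (lt_mem_nhds hc)

theorem lex_ev (a b c : ℝ) (h : 0 < a ∨ (a = 0 ∧ (0 < b ∨ (b = 0 ∧ 0 < c)))) :
    ∀ᶠ ε in 𝓝[>] (0 : ℝ), ∀ᶠ δ in 𝓝[>] (0 : ℝ), 0 < a + ε * b + δ * c := by
  rcases h with h | ⟨rfl, h | ⟨rfl, h⟩⟩
  · filter_upwards [ev_small a b h] with ε hε
    exact ev_small _ c hε
  · filter_upwards [self_mem_nhdsWithin] with ε hε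
    have : 0 < 0 + ε * b := by
      have : 0 < ε * b := mul_pos hε h
      linarith
    exact ev_small _ c this
  · filter_upwards with ε
    filter_upwards [self_mem_nhdsWithin] with δ hδ
    have : 0 < δ * c := mul_pos hδ h
    linarith

theorem lexPos_ev (v : ℕ → Pt) (z u w : Pt) (i : ℕ) (h : LexPos v z u w i) :
    ∀ᶠ ε in 𝓝[>] (0 : ℝ), ∀ᶠ δ in 𝓝[>] (0 : ℝ), 0 < fg v i (z + ε • u + δ • w) := by
  simp only [fg_shift]
  exact lex_ev _ _ _ h

theorem lexNeg_ev (v : ℕ → Pt) (z u w : Pt) (i : ℕ) (h : ¬ LexPos v z u w i)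
    (hw : cr (ed v i) u = 0 → cr (ed v i) w ≠ 0) :
    ∀ᶠ ε in 𝓝[>] (0 : ℝ), ∀ᶠ δ in 𝓝[>] (0 : ℝ), fg v i (z + ε • u + δ • w) < 0 := by
  simp only [fg_shift]
  have := lex_ev (-fg v i z) (-cr (ed v i) u) (-cr (ed v i) w) (by
    unfold LexPos at h
    push Not at h
    obtain ⟨h1, h2⟩ := h
    rcases h1.lt_or_eq with h1 | h1
    · left; linarith
    · right
      obtain ⟨h3, h4⟩ := h2 h1
      refine ⟨by linarith, ?_⟩
      rcases h3.lt_or_eq with h3 | h3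
      · left; linarith
      · right
        refine ⟨by linarith, ?_⟩
        rcases (h4 h3).lt_or_eq with h5 | h5
        · linarith
        · exact absurd h5 (hw h3))
  filter_upwards [this] with ε h1
  filter_upwards [h1] with δ h2
  linarith

/-- Either the germ is inside, or outside. -/
theorem Dodec.in_ev {v : ℕ → Pt} (h : Dodec v) (z u w : Pt)
    (hl : ∀ i < 12, LexPos v z u w i) :
    ∀ᶠ ε in 𝓝[>] (0 : ℝ), ∀ᶠ δ in 𝓝[>] (0 : ℝ),
      z + ε • u + δ • w ∈ interior (convexHull ℝ (range v)) := by
  have : ∀ᶠ ε in 𝓝[>] (0 : ℝ), ∀ᶠ δ in 𝓝[>] (0 : ℝ), ∀ i ∈ Finset.range 12,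
      0 < fg v i (z + ε • u + δ • w) := by
    have h1 : ∀ᶠ ε in 𝓝[>] (0 : ℝ), ∀ i ∈ Finset.range 12, ∀ᶠ δ in 𝓝[>] (0 : ℝ),
      0 < fg v i (z + ε • u + δ • w) := by
      rw [Filter.eventually_all_finset]
      intro i hi
      exact lexPos_ev v z u w i (hl i (by simpa using hi))
    filter_upwards [h1] with ε h2
    rw [Filter.eventually_all_finset]
    exact h2
  filter_upwards [this] with ε h1
  filter_upwards [h1] with δ h2
  exact h.mem_int fun i hi => h2 i (by simpa using hi)

theorem Dodec.out_ev {v : ℕ → Pt} (h : Dodec v) (z u w : Pt) (i : ℕ)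
    (hl : ¬ LexPos v z u w i) (hw : cr (ed v i) u = 0 → cr (ed v i) w ≠ 0) :
    ∀ᶠ ε in 𝓝[>] (0 : ℝ), ∀ᶠ δ in 𝓝[>] (0 : ℝ),
      z + ε • u + δ • w ∉ convexHull ℝ (range v) := by
  filter_upwards [lexNeg_ev v z u w i hl hw] with ε h1
  filter_upwards [h1] with δ h2
  intro hm
  exact absurd (h.facet hm i) (not_le.2 h2)

theorem Dodec.fg_zero_mod {v : ℕ → Pt} (h : Dodec v) (i j : ℕ) (hz : fg v j (v i) = 0) :
    ∃ d, d < 12 ∧ v i = v (j + d) ∧ d < 2 := by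
  obtain ⟨d, hd, e⟩ := h.exists_off j i
  refine ⟨d, hd, e, ?_⟩
  by_contra hc
  have := h.fg_pos j d (by omega) hd
  rw [← e] at this
  linarith

/-- cross products of edges never vanish unless the edges are parallel. -/
theorem Dodec.ed_off {v : ℕ → Pt} (h : Dodec v) (i l : ℕ) :
    ∃ d, d < 12 ∧ ed v l = ed v (i + d) ∧ ∀ x, fg v l x = fg v (i + d) x := by
  refine ⟨(l + 11 * i) % 12, Nat.mod_lt _ (by norm_num), ?_⟩
  have e1 := h.per_mul l i
  have e2 := h.per_mul (i + (l + 11 * i) % 12) ((l + 11 * i) / 12)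
  have e3 := h.per_mul (l + 1) i
  have e4 := h.per_mul (i + (l + 11 * i) % 12 + 1) ((l + 11 * i) / 12)
  have a1 : i + (l + 11 * i) % 12 + 12 * ((l + 11 * i) / 12) = l + 12 * i := by omega
  have a2 : i + (l + 11 * i) % 12 + 1 + 12 * ((l + 11 * i) / 12) = l + 1 + 12 * i := by omega
  rw [a1] at e2
  rw [a2] at e4
  have : ed v l = ed v (i + (l + 11 * i) % 12) := by
    unfold ed
    rw [← e1, ← e2, ← e3, ← e4]
  refine ⟨this, fun x => ?_⟩
  unfold fg
  rw [this, ← e1, ← e2]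

theorem Dodec.ed_zero {v : ℕ → Pt} (h : Dodec v) (i d : ℕ) (hd : d < 12)
    (hz : cr (ed v (i + d)) (ed v i) = 0) : d = 0 ∨ d = 6 := by
  by_contra! hc
  rcases Nat.lt_or_ge d 6 with h6 | h6
  · have := h.ed_pos i (i + d) (by omega) (by omega)
    simp only [cr] at *
    linarith
  · have := h.ed_pos i (i + (d - 6)) (by omega) (by omega)
    rw [show i + d = i + (d - 6) + 6 by omega, h.ed_anti] at hz
    simp only [cr, Prod.fst_neg, Prod.snd_neg] at *
    linarith

/-- Key germ lemma: along the `i`-th edge away from its end point. -/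
theorem Dodec.lex_edge {v : ℕ → Pt} (h : Dodec v) (i : ℕ) (z w : Pt)
    (hz : fg v i z = 0) (hne : z ≠ v (i + 1)) (hw : 0 < cr (ed v i) w)
    (hl : ∀ j, LexPos v z (-ed v i) w j) : ∀ j, LexPos v z (ed v i) w j := by
  intro j
  obtain ⟨d, hd, e1, e2⟩ := h.ed_off i j
  rcases hl j with h1 | ⟨h1, h2 | ⟨h2, h3⟩⟩
  · exact Or.inl h1
  · exfalso
    have hneg : cr (ed v j) (ed v i) < 0 := by
      simp only [cr, Prod.fst_neg, Prod.snd_neg] at *; linarith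
    -- z is on the line of the edge
    have hE : 0 < cr (ed v i) (ed v (i + 1)) := h.ed_pos i (i + 1) (by omega) (by omega)
    have hc1 : 0 ≤ fg v (i + 1) z := by
      rcases hl (i + 1) with h | h
      · exact h.le
      · exact h.1.ge
    set E := ed v i with hEd
    set F := ed v (i + 1) with hFd
    -- coordinate along the edge
    set t := fg v (i + 1) z / cr E F with ht
    have hzt : z = v (i + 1) - t • E := by
      have hne := hE.ne'
      have hz' : cr E (z - v (i + 1)) = 0 := by
        have : cr E (z - v (i + 1)) = fg v i z := by
          simp [fg, cr, hEd, ed]; ring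
        rw [this, hz]
      have h5 : fg v (i + 1) z = cr F (z - v (i + 1)) := rfl
      have key1 : (z - v (i + 1)).1 * cr E F = - cr F (z - v (i + 1)) * E.1 
          + cr E (z - v (i + 1)) * F.1 := by
        simp only [cr]; ring
      have key2 : (z - v (i + 1)).2 * cr E F = - cr F (z - v (i + 1)) * E.2 
          + cr E (z - v (i + 1)) * F.2 := by
        simp only [cr]; ring
      rw [hz'] at key1 key2
      rw [ht, h5]
      ext
      · simp only [Prod.fst_sub, Prod.smul_fst, smul_eq_mul] at *
        field_simp
        linarith
      · simp only [Prod.snd_sub, Prod.smul_snd, smul_eq_mul] at *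
        field_simp
        linarith
    have ht0 : 0 ≤ t := div_nonneg hc1 hE.le
    have ht1 : 0 < t := by
      rcases ht0.lt_or_eq with h | h
      · exact h
      · exfalso; apply hne; rw [hzt, ← h]; simp
    have hb := h.fg_nonneg j (i + 1)
    have : fg v j z = fg v j (v (i + 1)) - t * cr (ed v j) E := by
      rw [hzt]; simp [fg, cr]; ring
    nlinarith
  · right
    refine ⟨h1, Or.inr ⟨?_, h3⟩⟩
    simp only [cr, Prod.fst_neg, Prod.snd_neg] at *; linarith

theorem Dodec.lex_start {v : ℕ → Pt} (h : Dodec v) (i : ℕ) (w : Pt)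
    (hw : 0 < cr (ed v i) w) : ∀ j, LexPos v (v i) (ed v i) w j := by
  intro j
  obtain ⟨d, hd, e1, e2⟩ := h.ed_off i j
  unfold LexPos
  rw [e1, e2]
  rcases Nat.eq_zero_or_pos d with rfl | hd0
  · right
    refine ⟨fg_self v i, Or.inr ⟨?_, hw⟩⟩
    simp [cr]; ring
  · have hv : v i = v (i + d + (12 - d)) := by
      rw [show i + d + (12 - d) = i + 12 by omega, h.per]
    rcases Nat.lt_or_ge d 11 with h11 | h11
    · left
      rw [hv]
      exact h.fg_pos (i + d) (12 - d) (by omega) (by omega)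
    · have : d = 11 := by omega
      subst this
      right
      refine ⟨by rw [hv]; exact fg_succ v (i + 11), Or.inl ?_⟩
      have := h.ed_pos i (i + 5) (by omega) (by omega)
      rw [show i + 11 = i + 5 + 6 by ring, h.ed_anti]
      simp only [cr, Prod.fst_neg, Prod.snd_neg] at *
      linarith

end

section
open Filter Topology

theorem cr_neg_left (a b : Pt) : cr (-a) b = -cr a b := by simp [cr]; ring
theorem cr_neg_right (a b : Pt) : cr a (-b) = -cr a b := by simp [cr]; ring
theorem cr_self (a : Pt) : cr a a = 0 := by simp [cr]; ring

/-- an edge parallel to `ed v i` is the edge `i` or `i + 6`. -/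
theorem Dodec.par {v : ℕ → Pt} (h : Dodec v) (i j : ℕ) (hz : cr (ed v j) (ed v i) = 0) :
    (ed v j = ed v i ∧ ∀ x, fg v j x = fg v i x) ∨
    (ed v j = -ed v i ∧ ∀ x, fg v j x = fg v (i + 6) x) := by
  obtain ⟨d, hd, e1, e2⟩ := h.ed_off i j
  rw [e1] at hz
  rcases h.ed_zero i d hd hz with rfl | rfl
  · exact Or.inl ⟨e1, e2⟩
  · exact Or.inr ⟨by rw [e1, h.ed_anti], e2⟩

theorem Dodec.in_or_out {v : ℕ → Pt} (h : Dodec v) (z u w : Pt)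
    (hu : ∀ j, cr (ed v j) u = 0 → cr (ed v j) w ≠ 0) :
    (∀ j, LexPos v z u w j) ∨ ∀ᶠ ε in 𝓝[>] (0 : ℝ), ∀ᶠ δ in 𝓝[>] (0 : ℝ),
      z + ε • u + δ • w ∉ convexHull ℝ (range v) := by
  by_cases hl : ∀ j, LexPos v z u w j
  · exact Or.inl hl
  · push Not at hl
    obtain ⟨j, hj⟩ := hl
    exact Or.inr (h.out_ev z u w j hj (hu j))

/-- The local second-difference inequality. -/
theorem Dodec.germ {v : ℕ → Pt} (h : Dodec v) (i : ℕ) (z n : Pt) (hn : 0 < cr (ed v i) n)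
    (hz1 : z ≠ v (i + 1)) (hz2 : z ≠ -v (i + 1)) :
    ∀ᶠ ε in 𝓝[>] (0 : ℝ), ∀ᶠ δ in 𝓝[>] (0 : ℝ),
      (z + ε • ed v i + δ • (-n) ∈ convexHull ℝ (range v) →
        z + ε • ed v i + δ • n ∈ interior (convexHull ℝ (range v)) ∨
        z + ε • (-ed v i) + δ • (-n) ∈ interior (convexHull ℝ (range v))) ∧
      (z + ε • (-ed v i) + δ • n ∈ convexHull ℝ (range v) →
        z + ε • ed v i + δ • n ∈ interior (convexHull ℝ (range v)) ∨
        z + ε • (-ed v i) + δ • (-n) ∈ interior (convexHull ℝ (range v))) ∧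
      (z + ε • ed v i + δ • (-n) ∈ convexHull ℝ (range v) →
        z + ε • (-ed v i) + δ • n ∈ convexHull ℝ (range v) →
        z + ε • ed v i + δ • n ∈ interior (convexHull ℝ (range v)) ∧
        z + ε • (-ed v i) + δ • (-n) ∈ interior (convexHull ℝ (range v))) := by
  have hgen : ∀ j, cr (ed v j) (ed v i) = 0 → cr (ed v j) n ≠ 0 := by
    intro j hj
    rcases h.par i j hj with ⟨e, -⟩ | ⟨e, -⟩
    · rw [e]; exact hn.ne'
    · rw [e, cr_neg_left]; exact neg_ne_zero.2 hn.ne'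
  have g1 : ∀ j, cr (ed v j) (ed v i) = 0 → cr (ed v j) (-n) ≠ 0 := by
    intro j hj; rw [cr_neg_right]; exact neg_ne_zero.2 (hgen j hj)
  have g2 : ∀ j, cr (ed v j) (-ed v i) = 0 → cr (ed v j) n ≠ 0 := by
    intro j hj; rw [cr_neg_right] at hj; exact hgen j (neg_eq_zero.1 hj)
  by_cases c1 : fg v i z = 0
  · -- on the line of the edge `i`
    have o1 := h.out_ev z (ed v i) (-n) i (by
      unfold LexPos
      rw [c1, cr_self, cr_neg_right]
      push Not
      exact ⟨le_rfl, fun _ => ⟨le_rfl, fun _ => by linarith⟩⟩) (g1 i)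
    rcases h.in_or_out z (-ed v i) n g2 with l2 | o2
    · have I1 := h.in_ev z (ed v i) n fun j _ => h.lex_edge i z n c1 hz1 hn l2 j
      filter_upwards [o1, I1] with ε a1 a2
      filter_upwards [a1, a2] with δ b1 b2
      exact ⟨fun _ => Or.inl b2, fun _ => Or.inl b2, fun hh => absurd hh b1⟩
    · filter_upwards [o1, o2] with ε a1 a2
      filter_upwards [a1, a2] with δ b1 b2
      exact ⟨fun hh => absurd hh b1, fun hh => absurd hh b2, fun hh => absurd hh b1⟩
  by_cases c2 : fg v (i + 6) z = 0
  · have o2 := h.out_ev z (-ed v i) n (i + 6) (by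
      unfold LexPos
      rw [c2, h.ed_anti, cr_self, cr_neg_left]
      push Not
      exact ⟨le_rfl, fun _ => ⟨le_rfl, fun _ => by linarith⟩⟩) (g2 (i + 6))
    rcases h.in_or_out z (ed v i) (-n) g1 with l1 | o1
    · have I2 := h.in_ev z (-ed v i) (-n) fun j _ => by
        have := h.lex_edge (i + 6) z (-n) c2 (by
          rw [show i + 6 + 1 = i + 1 + 6 by ring, h.anti]; exact hz2) (by
          rw [h.ed_anti, cr_neg_left, cr_neg_right]; linarith) (by
          rw [h.ed_anti, neg_neg]; exact l1) j
        rwa [h.ed_anti] at this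
      filter_upwards [o2, I2] with ε a1 a2
      filter_upwards [a1, a2] with δ b1 b2
      exact ⟨fun _ => Or.inr b2, fun _ => Or.inr b2, fun _ hh => absurd hh b1⟩
    · filter_upwards [o1, o2] with ε a1 a2
      filter_upwards [a1, a2] with δ b1 b2
      exact ⟨fun hh => absurd hh b1, fun hh => absurd hh b2, fun hh => absurd hh b1⟩
  · -- off both lines
    have flip : ∀ u w w', (u = ed v i ∨ u = -ed v i) → (∀ j, LexPos v z u w j) →
        ∀ j, LexPos v z u w' j := by
      intro u w w' hu hl j
      rcases hl j with a | ⟨a, b | ⟨b, -⟩⟩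
      · exact Or.inl a
      · exact Or.inr ⟨a, Or.inl b⟩
      · exfalso
        have b' : cr (ed v j) (ed v i) = 0 := by
          rcases hu with rfl | rfl
          · exact b
          · rw [cr_neg_right] at b; linarith
        rcases h.par i j b' with ⟨-, e⟩ | ⟨-, e⟩
        · exact c1 (by rw [← e, a])
        · exact c2 (by rw [← e, a])
    have A : ∀ᶠ ε in 𝓝[>] (0 : ℝ), ∀ᶠ δ in 𝓝[>] (0 : ℝ),
        (z + ε • ed v i + δ • (-n) ∈ convexHull ℝ (range v) →
          z + ε • ed v i + δ • n ∈ interior (convexHull ℝ (range v))) := by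
      rcases h.in_or_out z (ed v i) (-n) g1 with l1 | o1
      · have := h.in_ev z (ed v i) n fun j _ => flip _ _ n (Or.inl rfl) l1 j
        filter_upwards [this] with ε a1
        filter_upwards [a1] with δ b1 _ using b1
      · filter_upwards [o1] with ε a1
        filter_upwards [a1] with δ b1 b2 using absurd b2 b1
    have B : ∀ᶠ ε in 𝓝[>] (0 : ℝ), ∀ᶠ δ in 𝓝[>] (0 : ℝ),
        (z + ε • (-ed v i) + δ • n ∈ convexHull ℝ (range v) →
          z + ε • (-ed v i) + δ • (-n) ∈ interior (convexHull ℝ (range v))) := by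
      rcases h.in_or_out z (-ed v i) n g2 with l1 | o1
      · have := h.in_ev z (-ed v i) (-n) fun j _ => flip _ _ (-n) (Or.inr rfl) l1 j
        filter_upwards [this] with ε a1
        filter_upwards [a1] with δ b1 _ using b1
      · filter_upwards [o1] with ε a1
        filter_upwards [a1] with δ b1 b2 using absurd b2 b1
    filter_upwards [A, B] with ε a1 a2
    filter_upwards [a1, a2] with δ b1 b2
    exact ⟨fun hh => Or.inl (b1 hh), fun hh => Or.inr (b2 hh), fun h1 h2 => ⟨b1 h1, b2 h2⟩⟩

/-- The strict version at the starting vertex of the edge. -/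
theorem Dodec.germ_strict {v : ℕ → Pt} (h : Dodec v) (i : ℕ) (n : Pt)
    (hn : 0 < cr (ed v i) n) :
    ∀ᶠ ε in 𝓝[>] (0 : ℝ), ∀ᶠ δ in 𝓝[>] (0 : ℝ),
      v i + ε • ed v i + δ • n ∈ interior (convexHull ℝ (range v)) ∧
      v i + ε • ed v i + δ • (-n) ∉ convexHull ℝ (range v) ∧
      v i + ε • (-ed v i) + δ • n ∉ convexHull ℝ (range v) := by
  have I := h.in_ev (v i) (ed v i) n fun j _ => h.lex_start i n hn j
  have o1 := h.out_ev (v i) (ed v i) (-n) i (by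
      unfold LexPos
      rw [fg_self, cr_self, cr_neg_right]
      push Not
      exact ⟨le_rfl, fun _ => ⟨le_rfl, fun _ => by linarith⟩⟩)
      (fun _ => by rw [cr_neg_right]; exact neg_ne_zero.2 hn.ne')
  have hlt : 0 < cr (ed v (i + 11)) (ed v i) := by
    have := h.ed_pos i (i + 5) (by omega) (by omega)
    rw [show i + 11 = i + 5 + 6 by ring, h.ed_anti]
    simp only [cr, Prod.fst_neg, Prod.snd_neg] at *
    linarith
  have o2 := h.out_ev (v i) (-ed v i) n (i + 11) (by
      unfold LexPos
      have : fg v (i + 11) (v i) = 0 := by rw [← h.per i]; exact fg_succ v (i + 11)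
      rw [this, cr_neg_right]
      push Not
      exact ⟨le_rfl, fun _ => ⟨by linarith, fun _ => by linarith⟩⟩)
      (fun h0 => by rw [cr_neg_right] at h0; linarith)
  filter_upwards [I, o1, o2] with ε a1 a2 a3
  filter_upwards [a1, a2, a3] with δ b1 b2 b3
  exact ⟨b1, b2, b3⟩

theorem intLattice_finite_s8 (M : ℝ) : {z ∈ IntLattice | ‖z‖ ≤ M}.Finite := by
  have : {z ∈ IntLattice | ‖z‖ ≤ M} ⊆
      (fun p : ℤ × ℤ => (((p.1 : ℝ), (p.2 : ℝ)) : Pt)) ''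
        ((Icc (-⌈M⌉) ⌈M⌉) ×ˢ (Icc (-⌈M⌉) ⌈M⌉)) := by
    rintro _ ⟨⟨a, b, rfl⟩, hz⟩
    refine ⟨(a, b), ?_, rfl⟩
    have h1 : |(a : ℝ)| ≤ M := (norm_fst_le _).trans hz
    have h2 : |(b : ℝ)| ≤ M := (norm_snd_le _).trans hz
    have hM := Int.le_ceil M
    rw [abs_le] at h1 h2
    simp only [mem_prod, mem_Icc]
    refine ⟨⟨?_, ?_⟩, ?_, ?_⟩ <;> (rify; linarith)
  exact Set.Finite.subset ((Set.finite_Icc _ _ |>.prod (Set.finite_Icc _ _)).image _) this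

theorem intLattice_zero : (0 : Pt) ∈ IntLattice := ⟨0, 0, by ext <;> simp⟩
theorem intLattice_neg {x : Pt} (h : x ∈ IntLattice) : -x ∈ IntLattice := by
  obtain ⟨a, b, rfl⟩ := h; exact ⟨-a, -b, by simp⟩
theorem intLattice_add {x y : Pt} (h : x ∈ IntLattice) (h' : y ∈ IntLattice) :
    x + y ∈ IntLattice := by
  obtain ⟨a, b, rfl⟩ := h; obtain ⟨c, d, rfl⟩ := h'
  exact ⟨a + c, b + d, by simp⟩
theorem intLattice_sub {x y : Pt} (h : x ∈ IntLattice) (h' : y ∈ IntLattice) :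
    x - y ∈ IntLattice := by
  rw [sub_eq_add_neg]; exact intLattice_add h (intLattice_neg h')

theorem ite_ineq (A B C D : Prop) [Decidable A] [Decidable B] [Decidable C] [Decidable D]
    (h1 : C → A ∨ B) (h2 : D → A ∨ B) (h3 : C → D → A ∧ B) :
    ((if C then 1 else 0) + (if D then 1 else 0) : ℕ) ≤
      (if A then 1 else 0) + (if B then 1 else 0) := by
  by_cases A <;> by_cases B <;> by_cases C <;> by_cases D <;> simp_all

/-- Every edge vector, or twice every edge midpoint, is a lattice vector. -/
theorem Dodec.edge_condition {v : ℕ → Pt} (h : Dodec v) (k : ℕ)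
    (hcov : ∀ p : Pt, (k : ℕ∞) ≤ {l ∈ IntLattice | p - l ∈ convexHull ℝ (range v)}.encard)
    (hpack : ∀ p : Pt,
      {l ∈ IntLattice | p - l ∈ interior (convexHull ℝ (range v))}.encard ≤ (k : ℕ∞))
    (hbd : Bornology.IsBounded (convexHull ℝ (range v))) (i : ℕ) :
    ed v i ∈ IntLattice ∨ v i + v (i + 1) ∈ IntLattice := by
  classical
  by_contra! hcon
  obtain ⟨hA, hB⟩ := hcon
  set Q := convexHull ℝ (range v) with hQ
  obtain ⟨M, hM⟩ := hbd.exists_norm_le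
  set n : Pt := -v i with hn
  set e := ed v i with he
  have hnp : 0 < cr e n := by
    have := h.pos i (i + 1) (by omega) (by omega)
    have e1 : cr e n = cr (v i) (v (i + 1)) := by simp [he, hn, ed, cr]; ring
    rw [e1]; exact this
  set R := ‖v i‖ + ‖e‖ + ‖n‖ + M with hR
  have hF := intLattice_finite_s8 R
  set F := hF.toFinset with hFd
  have hz : ∀ l ∈ F, v i - l ≠ v (i + 1) ∧ v i - l ≠ -v (i + 1) := by
    intro l hl
    have hl' : l ∈ IntLattice := ((hF.mem_toFinset).1 hl).1
    constructor
    · intro h1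
      apply hA
      have : e = -l := by rw [he, ed, ← h1]; abel
      rw [this]; exact intLattice_neg hl'
    · intro h1
      apply hB
      have : v i + v (i + 1) = l := by
        rw [← neg_neg (v (i + 1)), ← h1]; abel
      rw [this]; exact hl'
  have hg : ∀ᶠ ε in 𝓝[>] (0 : ℝ), ∀ᶠ δ in 𝓝[>] (0 : ℝ), ∀ l ∈ F,
      (v i - l + ε • e + δ • (-n) ∈ Q →
        v i - l + ε • e + δ • n ∈ interior Q ∨ v i - l + ε • (-e) + δ • (-n) ∈ interior Q) ∧
      (v i - l + ε • (-e) + δ • n ∈ Q →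
        v i - l + ε • e + δ • n ∈ interior Q ∨ v i - l + ε • (-e) + δ • (-n) ∈ interior Q) ∧
      (v i - l + ε • e + δ • (-n) ∈ Q → v i - l + ε • (-e) + δ • n ∈ Q →
        v i - l + ε • e + δ • n ∈ interior Q ∧
          v i - l + ε • (-e) + δ • (-n) ∈ interior Q) := by
    have := (Filter.eventually_all_finset F).2 fun l hl =>
      h.germ i (v i - l) n hnp (hz l hl).1 (hz l hl).2
    filter_upwards [this] with ε h1
    exact (Filter.eventually_all_finset F).2 h1
  have hsmall : ∀ᶠ ε in 𝓝[>] (0 : ℝ), |ε| ≤ 1 := by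
    have : ∀ᶠ ε in 𝓝 (0 : ℝ), |ε| < 1 := by
      have := (continuous_abs (G := ℝ)).tendsto 0
      rw [abs_zero] at this
      exact this.eventually (gt_mem_nhds one_pos)
    filter_upwards [nhdsWithin_le_nhds this] with ε h1 using h1.le
  obtain ⟨ε, hε⟩ := (hg.and ((h.germ_strict i n hnp).and hsmall)).exists
  obtain ⟨hε1, hε2, hε3⟩ := hε
  obtain ⟨δ, hδ1, hδ2, hδ3⟩ := (hε1.and (hε2.and hsmall)).exists
  clear hg hε1 hε2 hsmall
  -- counting
  have hmemF : ∀ l ∈ IntLattice, ∀ s t : Pt, ‖s‖ = ‖e‖ → ‖t‖ = ‖n‖ →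
      v i + ε • s + δ • t - l ∈ Q → l ∈ F := by
    intro l hl s t hs ht hm
    rw [hF.mem_toFinset]
    refine ⟨hl, ?_⟩
    have h1 := hM _ hm
    have h2 : ‖ε • s‖ ≤ ‖e‖ := by
      rw [norm_smul, hs, Real.norm_eq_abs]
      nlinarith [norm_nonneg e]
    have h3 : ‖δ • t‖ ≤ ‖n‖ := by
      rw [norm_smul, ht, Real.norm_eq_abs]
      nlinarith [norm_nonneg n]
    have h4 : l = v i + ε • s + δ • t - (v i + ε • s + δ • t - l) := by abel
    rw [h4]
    calc _ ≤ ‖v i + ε • s + δ • t‖ + ‖v i + ε • s + δ • t - l‖ := norm_sub_le _ _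
      _ ≤ ‖v i‖ + ‖ε • s‖ + ‖δ • t‖ + M := add_le_add norm_add₃_le h1
      _ ≤ R := by rw [hR]; linarith
  have hcovF : ∀ s t : Pt, ‖s‖ = ‖e‖ → ‖t‖ = ‖n‖ →
      k ≤ ∑ l ∈ F, if v i - l + ε • s + δ • t ∈ Q then 1 else 0 := by
    intro s t hs ht
    have h1 := hcov (v i + ε • s + δ • t)
    have h2 : {l ∈ IntLattice | v i + ε • s + δ • t - l ∈ Q} ⊆
        ((F.filter fun l => v i - l + ε • s + δ • t ∈ Q : Finset Pt) : Set Pt) := by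
      rintro l ⟨hl, hm⟩
      simp only [Finset.coe_filter, mem_ofPred_eq]
      refine ⟨hmemF l hl s t hs ht hm, ?_⟩
      rwa [show v i - l + ε • s + δ • t = v i + ε • s + δ • t - l by abel]
    have h3 := h1.trans (Set.encard_le_encard h2)
    rw [Set.encard_coe_eq_coe_finsetCard] at h3
    rw [← Finset.card_filter]
    exact_mod_cast h3
  have hpackF : ∀ s t : Pt,
      (∑ l ∈ F, if v i - l + ε • s + δ • t ∈ interior Q then 1 else 0) ≤ k := by
    intro s t
    have h1 := hpack (v i + ε • s + δ • t)
    have h2 : ((F.filter fun l => v i - l + ε • s + δ • t ∈ interior Q : Finset Pt) : Set Pt) ⊆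
        {l ∈ IntLattice | v i + ε • s + δ • t - l ∈ interior Q} := by
      intro l hl
      simp only [Finset.coe_filter, mem_ofPred_eq] at hl
      refine ⟨((hF.mem_toFinset).1 hl.1).1, ?_⟩
      rw [show v i + ε • s + δ • t - l = v i - l + ε • s + δ • t by abel]
      exact hl.2
    have h3 := (Set.encard_le_encard h2).trans h1
    rw [Set.encard_coe_eq_coe_finsetCard] at h3
    rw [← Finset.card_filter]
    exact_mod_cast h3
  have c1 := hcovF e (-n) rfl (norm_neg _)
  have c2 := hcovF (-e) n (norm_neg _) rfl
  have p1 := hpackF e n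
  have p2 := hpackF (-e) (-n)
  have hlt : (∑ l ∈ F, ((if v i - l + ε • e + δ • (-n) ∈ Q then 1 else 0) +
        (if v i - l + ε • (-e) + δ • n ∈ Q then 1 else 0))) <
      ∑ l ∈ F, ((if v i - l + ε • e + δ • n ∈ interior Q then 1 else 0) +
        (if v i - l + ε • (-e) + δ • (-n) ∈ interior Q then 1 else 0)) := by
    apply Finset.sum_lt_sum
    · intro l hl
      obtain ⟨g1, g2, g3⟩ := hδ1 l hl
      exact ite_ineq _ _ _ _ g1 g2 g3
    · refine ⟨0, ?_, ?_⟩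
      · rw [hF.mem_toFinset]
        refine ⟨intLattice_zero, ?_⟩
        have : 0 ≤ M := (norm_nonneg _).trans (hM 0 h.zero_mem)
        rw [norm_zero, hR]; positivity
      · obtain ⟨g1, g2, g3⟩ := hδ2
        rw [sub_zero, if_neg g2, if_neg g3, if_pos g1]
        omega
  rw [Finset.sum_add_distrib, Finset.sum_add_distrib] at hlt
  omega

end

theorem cr_int {x y : Pt} (hx : x ∈ IntLattice) (hy : y ∈ IntLattice) :
    ∃ m : ℤ, cr x y = m := by
  obtain ⟨a, b, rfl⟩ := hx
  obtain ⟨c, d, rfl⟩ := hy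
  exact ⟨a * d - b * c, by simp [cr]⟩

theorem cr_one_le {x y : Pt} (hx : x ∈ IntLattice) (hy : y ∈ IntLattice) (h : 0 < cr x y) :
    1 ≤ cr x y := by
  obtain ⟨m, hm⟩ := cr_int hx hy
  rw [hm] at h ⊢
  have : 0 < m := by exact_mod_cast h
  exact_mod_cast this

theorem two_le_of_mul {x y : ℤ} (hx : 1 ≤ x) (hy : 1 ≤ y) (h : 2 ≤ x * y) : 3 ≤ x + y := by
  by_contra hc
  have h1 : x = 1 := by omega
  have h2 : y = 1 := by omega
  subst h1; subst h2; omega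

/-- The arithmetic heart of the decagon bound. -/
theorem pent_int (p0 p1 p2 p3 p4 q0 q1 q2 q3 q4 : ℤ)
    (hp0 : 1 ≤ p0) (hp1 : 1 ≤ p1) (hp2 : 1 ≤ p2) (hp3 : 1 ≤ p3) (hp4 : 1 ≤ p4)
    (hq0 : 1 ≤ q0) (hq1 : 1 ≤ q1) (hq2 : 1 ≤ q2) (hq3 : 1 ≤ q3) (hq4 : 1 ≤ q4)
    (r0 : p0 - p4 = q3 - q0) (r1 : p1 - p0 = q4 - q1) (r2 : p2 - p1 = q0 - q2)
    (r3 : p3 - p2 = q1 - q3)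
    (k0 : p0 * p2 = q0 * q1 + q3 * p1) (k1 : p1 * p3 = q1 * q2 + q4 * p2)
    (k2 : p2 * p4 = q2 * q3 + q0 * p3) (k3 : p3 * p0 = q3 * q4 + q1 * p4)
    (k4 : p4 * p1 = q4 * q0 + q2 * p0) :
    20 ≤ p0 + p1 + p2 + p3 + p4 + 2 * (q0 + q1 + q2 + q3 + q4) := by
  have m : ∀ x y : ℤ, 1 ≤ x → 1 ≤ y → 1 ≤ x * y := fun x y hx hy => by nlinarith
  have a0 := two_le_of_mul hp0 hp2 (by linarith [m _ _ hq0 hq1, m _ _ hq3 hp1])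
  have a1 := two_le_of_mul hp1 hp3 (by linarith [m _ _ hq1 hq2, m _ _ hq4 hp2])
  have a2 := two_le_of_mul hp2 hp4 (by linarith [m _ _ hq2 hq3, m _ _ hq0 hp3])
  have a3 := two_le_of_mul hp3 hp0 (by linarith [m _ _ hq3 hq4, m _ _ hq1 hp4])
  have a4 := two_le_of_mul hp4 hp1 (by linarith [m _ _ hq4 hq0, m _ _ hq2 hp0])
  omega

theorem pos_int {x : ℝ} (h : ∃ m : ℤ, x = m) (hx : 0 < x) : ∃ m : ℤ, x = m ∧ 1 ≤ m := by
  obtain ⟨m, rfl⟩ := h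
  exact ⟨m, rfl, by exact_mod_cast hx⟩

/-- Decagon bound. -/
theorem decagon_bound (f1 f2 f3 f4 f5 : Pt)
    (h12 : 0 < cr f1 f2) (h13 : 0 < cr f1 f3) (h14 : 0 < cr f1 f4) (h15 : 0 < cr f1 f5)
    (h23 : 0 < cr f2 f3) (h24 : 0 < cr f2 f4) (h25 : 0 < cr f2 f5)
    (h34 : 0 < cr f3 f4) (h35 : 0 < cr f3 f5) (h45 : 0 < cr f4 f5)
    (s12 : f1 + f2 ∈ IntLattice) (s23 : f2 + f3 ∈ IntLattice)
    (s34 : f3 + f4 ∈ IntLattice) (s45 : f4 + f5 ∈ IntLattice) :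
    4 ≤ cr f1 f2 + cr f1 f3 + cr f1 f4 + cr f1 f5 + cr f2 f3 + cr f2 f4 + cr f2 f5
      + cr f3 f4 + cr f3 f5 + cr f4 f5 := by
  have s51 : f5 - f1 ∈ IntLattice := by
    have := intLattice_add (intLattice_sub s23 s12) (intLattice_sub s45 s34)
    convert this using 1; abel
  have d3 := intLattice_neg s23
  have d4 := intLattice_neg s45
  obtain ⟨p0, e0, P0⟩ := pos_int (cr_int s12 s34) (by
    simp only [cr, Prod.fst_add, Prod.snd_add] at *; linarith)
  obtain ⟨p1, e1, P1⟩ := pos_int (cr_int s34 s51) (by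
    simp only [cr, Prod.fst_add, Prod.snd_add, Prod.fst_sub, Prod.snd_sub] at *; linarith)
  obtain ⟨p2, e2, P2⟩ := pos_int (cr_int s51 d3) (by
    simp only [cr, Prod.fst_add, Prod.snd_add, Prod.fst_sub, Prod.snd_sub, Prod.fst_neg,
      Prod.snd_neg] at *; linarith)
  obtain ⟨p3, e3, P3⟩ := pos_int (cr_int d3 d4) (by
    simp only [cr, Prod.fst_add, Prod.snd_add, Prod.fst_sub, Prod.snd_sub, Prod.fst_neg,
      Prod.snd_neg] at *; linarith)
  obtain ⟨p4, e4, P4⟩ := pos_int (cr_int d4 s12) (by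
    simp only [cr, Prod.fst_add, Prod.snd_add, Prod.fst_sub, Prod.snd_sub, Prod.fst_neg,
      Prod.snd_neg] at *; linarith)
  obtain ⟨q0, g0, Q0⟩ := pos_int (cr_int s12 s51) (by
    simp only [cr, Prod.fst_add, Prod.snd_add, Prod.fst_sub, Prod.snd_sub, Prod.fst_neg,
      Prod.snd_neg] at *; linarith)
  obtain ⟨q1, g1, Q1⟩ := pos_int (cr_int s34 d3) (by
    simp only [cr, Prod.fst_add, Prod.snd_add, Prod.fst_sub, Prod.snd_sub, Prod.fst_neg,
      Prod.snd_neg] at *; linarith)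
  obtain ⟨q2, g2, Q2⟩ := pos_int (cr_int s51 d4) (by
    simp only [cr, Prod.fst_add, Prod.snd_add, Prod.fst_sub, Prod.snd_sub, Prod.fst_neg,
      Prod.snd_neg] at *; linarith)
  obtain ⟨q3, g3, Q3⟩ := pos_int (cr_int d3 s12) (by
    simp only [cr, Prod.fst_add, Prod.snd_add, Prod.fst_sub, Prod.snd_sub, Prod.fst_neg,
      Prod.snd_neg] at *; linarith)
  obtain ⟨q4, g4, Q4⟩ := pos_int (cr_int d4 s34) (by
    simp only [cr, Prod.fst_add, Prod.snd_add, Prod.fst_sub, Prod.snd_sub, Prod.fst_neg,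
      Prod.snd_neg] at *; linarith)
  have main := pent_int p0 p1 p2 p3 p4 q0 q1 q2 q3 q4 P0 P1 P2 P3 P4 Q0 Q1 Q2 Q3 Q4
    (by rify; rw [← e0, ← e4, ← g3, ← g0]; simp [cr]; ring)
    (by rify; rw [← e1, ← e0, ← g4, ← g1]; simp [cr]; ring)
    (by rify; rw [← e2, ← e1, ← g0, ← g2]; simp [cr]; ring)
    (by rify; rw [← e3, ← e2, ← g1, ← g3]; simp [cr]; ring)
    (by rify; rw [← e0, ← e2, ← g0, ← g1, ← g3, ← e1]; simp [cr]; ring)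
    (by rify; rw [← e1, ← e3, ← g1, ← g2, ← g4, ← e2]; simp [cr]; ring)
    (by rify; rw [← e2, ← e4, ← g2, ← g3, ← g0, ← e3]; simp [cr]; ring)
    (by rify; rw [← e3, ← e0, ← g3, ← g4, ← g1, ← e4]; simp [cr]; ring)
    (by rify; rw [← e4, ← e1, ← g4, ← g0, ← g2, ← e0]; simp [cr]; ring)
  have main' : (20 : ℝ) ≤ p0 + p1 + p2 + p3 + p4 + 2 * (q0 + q1 + q2 + q3 + q4) := by
    exact_mod_cast main
  rw [← e0, ← e1, ← e2, ← e3, ← e4, ← g0, ← g1, ← g2, ← g3, ← g4] at main'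
  simp only [cr, Prod.fst_add, Prod.snd_add, Prod.fst_sub, Prod.snd_sub, Prod.fst_neg,
      Prod.snd_neg] at *
  linarith

/-- The sum of the fifteen pairwise terms. -/
def pairSum (C : ℕ → ℕ → ℝ) : ℝ :=
  C 0 1 + C 0 2 + C 0 3 + C 0 4 + C 0 5 + C 1 2 + C 1 3 + C 1 4 + C 1 5 + C 2 3 + C 2 4 + C 2 5
    + C 3 4 + C 3 5 + C 4 5

set_option linter.unusedSimpArgs false in
theorem core_s8 {G : Type*} [AddCommGroup G] (y : ℕ → G) (C : ℕ → ℕ → ℝ)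
    (hs : ∀ i j, C i j = C j i)
    (hpos : ∀ i j, i < j → j < 6 → 0 < C i j)
    (L1 : ∀ i j, i < j → j < 6 → y (i + 1) = y i → y (j + 1) = y j → 1 ≤ C i j)
    (L2 : ∀ l i j, i < j → j < 6 → (l < i ∨ (j < l ∧ l < 6)) → y (l + 1) = y l →
      y (i + 1) - y i + (y (j + 1) - y j) = 0 → 1 ≤ C l i + C l j)
    (hdec : (∀ i, 1 ≤ i → i < 5 → y (i + 1) - y i + (y (i + 2) - y (i + 1)) = 0) →
      4 ≤ C 1 2 + C 1 3 + C 1 4 + C 1 5 + C 2 3 + C 2 4 + C 2 5 + C 3 4 + C 3 5 + C 4 5)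
    (hy6 : y 6 = -y 0) (h0 : y 1 = y 0)
    (h : ∀ i, y (i + 1) = y i ∨ y (i + 1) = -y i) : 6 < pairSum C := by
  unfold pairSum
  have z01 := hpos 0 1 (by norm_num) (by norm_num)
  have z02 := hpos 0 2 (by norm_num) (by norm_num)
  have z03 := hpos 0 3 (by norm_num) (by norm_num)
  have z04 := hpos 0 4 (by norm_num) (by norm_num)
  have z05 := hpos 0 5 (by norm_num) (by norm_num)
  have z12 := hpos 1 2 (by norm_num) (by norm_num)
  have z13 := hpos 1 3 (by norm_num) (by norm_num)
  have z14 := hpos 1 4 (by norm_num) (by norm_num)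
  have z15 := hpos 1 5 (by norm_num) (by norm_num)
  have z23 := hpos 2 3 (by norm_num) (by norm_num)
  have z24 := hpos 2 4 (by norm_num) (by norm_num)
  have z25 := hpos 2 5 (by norm_num) (by norm_num)
  have z34 := hpos 3 4 (by norm_num) (by norm_num)
  have z35 := hpos 3 5 (by norm_num) (by norm_num)
  have z45 := hpos 4 5 (by norm_num) (by norm_num)
  -- at most one exceptional edge
  have many : ∀ a, 1 ≤ a → a < 6 → (∀ i, i < 6 → i ≠ a → y (i + 1) = y i) →
      6 < C 0 1 + C 0 2 + C 0 3 + C 0 4 + C 0 5 + C 1 2 + C 1 3 + C 1 4 + C 1 5 + C 2 3 + C 2 4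
        + C 2 5 + C 3 4 + C 3 5 + C 4 5 := by
    intro a ha ha' hB
    have b : ∀ i j, i < j → j < 6 → i ≠ a → j ≠ a → 1 ≤ C i j := fun i j hij hj hi hj' =>
      L1 i j hij hj (hB i (by omega) hi) (hB j hj hj')
    interval_cases a
    · linarith [b 0 2 (by simp) (by simp) (by simp) (by simp), b 0 3 (by simp) (by simp) (by simp) (by simp), b 0 4 (by simp) (by simp) (by simp) (by simp), b 0 5 (by simp) (by simp) (by simp) (by simp), b 2 3 (by simp) (by simp) (by simp) (by simp), b 2 4 (by simp) (by simp) (by simp) (by simp), b 2 5 (by simp) (by simp) (by simp) (by simp)]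
    · linarith [b 0 1 (by simp) (by simp) (by simp) (by simp), b 0 3 (by simp) (by simp) (by simp) (by simp), b 0 4 (by simp) (by simp) (by simp) (by simp), b 0 5 (by simp) (by simp) (by simp) (by simp), b 1 3 (by simp) (by simp) (by simp) (by simp), b 1 4 (by simp) (by simp) (by simp) (by simp), b 1 5 (by simp) (by simp) (by simp) (by simp)]
    · linarith [b 0 1 (by simp) (by simp) (by simp) (by simp), b 0 2 (by simp) (by simp) (by simp) (by simp), b 0 4 (by simp) (by simp) (by simp) (by simp), b 0 5 (by simp) (by simp) (by simp) (by simp), b 1 2 (by simp) (by simp) (by simp) (by simp), b 1 4 (by simp) (by simp) (by simp) (by simp), b 1 5 (by simp) (by simp) (by simp) (by simp)]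
    · linarith [b 0 1 (by simp) (by simp) (by simp) (by simp), b 0 2 (by simp) (by simp) (by simp) (by simp), b 0 3 (by simp) (by simp) (by simp) (by simp), b 0 5 (by simp) (by simp) (by simp) (by simp), b 1 2 (by simp) (by simp) (by simp) (by simp), b 1 3 (by simp) (by simp) (by simp) (by simp), b 1 5 (by simp) (by simp) (by simp) (by simp)]
    · linarith [b 0 1 (by simp) (by simp) (by simp) (by simp), b 0 2 (by simp) (by simp) (by simp) (by simp), b 0 3 (by simp) (by simp) (by simp) (by simp), b 0 4 (by simp) (by simp) (by simp) (by simp), b 1 2 (by simp) (by simp) (by simp) (by simp), b 1 3 (by simp) (by simp) (by simp) (by simp), b 1 4 (by simp) (by simp) (by simp) (by simp)]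
  have even : y 0 = -y 0 → 6 < C 0 1 + C 0 2 + C 0 3 + C 0 4 + C 0 5 + C 1 2 + C 1 3 + C 1 4
        + C 1 5 + C 2 3 + C 2 4 + C 2 5 + C 3 4 + C 3 5 + C 4 5 := by
    intro he
    have hall : ∀ i, y i = y 0 := by
      intro i
      induction i with
      | zero => rfl
      | succ i ih =>
        rcases h i with h | h
        · rw [h, ih]
        · rw [h, ih, ← he]
    exact many 1 (by norm_num) (by norm_num) fun i _ _ => by rw [hall, hall i]
  -- three exceptional edges `a < b < d`
  have three : ∀ p q a b d, p < q → 1 ≤ p → q < 6 → 1 ≤ a → a < b → b < d → d < 6 →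
      p ≠ a → p ≠ b → p ≠ d → q ≠ a → q ≠ b → q ≠ d →
      y (p + 1) = y p → y (q + 1) = y q →
      y (a + 1) - y a + (y (b + 1) - y b) = 0 → y (b + 1) - y b + (y (d + 1) - y d) = 0 →
      6 < C 0 p + C 0 q + C p q + (C 0 a + C 0 b + C 0 d) + (C p a + C p b + C p d)
        + (C q a + C q b + C q d) := by
    intro p q a b d h1 h2 h3 h4 h5 h6 h7 n1 n2 n3 n4 n5 n6 hp hq hab hbd
    have cpos : ∀ i j, i ≠ j → i < 6 → j < 6 → 0 < C i j := by
      intro i j hij hi hj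
      rcases Nat.lt_or_gt_of_ne hij with hl | hl
      · exact hpos i j hl hj
      · rw [hs]; exact hpos j i hl hi
    have X : ∀ r, r < 6 → r ≠ a → r ≠ b → r ≠ d → y (r + 1) = y r →
        1 < C r a + C r b + C r d := by
      intro r hr ra rb rd hyr
      have y1 := cpos r a ra hr (by omega)
      have y2 := cpos r d rd hr (by omega)
      rcases Nat.lt_or_gt_of_ne rb with hl | hl
      · linarith [L2 r b d h6 h7 (Or.inl hl) hyr hbd]
      · linarith [L2 r a b h5 (by omega) (Or.inr ⟨hl, hr⟩) hyr hab]
    have := X 0 (by omega) (by omega) (by omega) (by omega) h0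
    have := X p (by omega) n1 n2 n3 hp
    have := X q (by omega) n4 n5 n6 hq
    linarith [L1 0 p (by omega) (by omega) h0 hp, L1 0 q (by omega) (by omega) h0 hq,
      L1 p q h1 h3 hp hq]
  have h1 : y 2 = y 1 ∨ y 2 = -y 1 := h 1
  have h2 : y 3 = y 2 ∨ y 3 = -y 2 := h 2
  have h3 : y 4 = y 3 ∨ y 4 = -y 3 := h 3
  have h4 : y 5 = y 4 ∨ y 5 = -y 4 := h 4
  have h5 : y 6 = y 5 ∨ y 6 = -y 5 := h 5
  have s21 := hs 2 1
  have s31 := hs 3 1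
  have s41 := hs 4 1
  have s51 := hs 5 1
  have s32 := hs 3 2
  have s42 := hs 4 2
  have s52 := hs 5 2
  have s43 := hs 4 3
  have s53 := hs 5 3
  have s54 := hs 5 4
  rcases h1 with h1 | h1 <;> rcases h2 with h2 | h2 <;> rcases h3 with h3 | h3 <;>
    rcases h4 with h4 | h4 <;> rcases h5 with h5 | h5
  · exact even (by rw [h5, h4, h3, h2, h1, h0] at hy6; simpa only [neg_neg] using hy6)
  · exact many 5 (by norm_num) (by norm_num) (fun i hi hne => by
      interval_cases i <;> first | exact absurd rfl hne | assumption)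
  · exact many 4 (by norm_num) (by norm_num) (fun i hi hne => by
      interval_cases i <;> first | exact absurd rfl hne | assumption)
  · exact even (by rw [h5, h4, h3, h2, h1, h0] at hy6; simpa only [neg_neg] using hy6)
  · exact many 3 (by norm_num) (by norm_num) (fun i hi hne => by
      interval_cases i <;> first | exact absurd rfl hne | assumption)
  · exact even (by rw [h5, h4, h3, h2, h1, h0] at hy6; simpa only [neg_neg] using hy6)
  · exact even (by rw [h5, h4, h3, h2, h1, h0] at hy6; simpa only [neg_neg] using hy6)
  · have T := three 1 2 3 4 5 (by norm_num) (by norm_num) (by norm_num) (by norm_num) (by norm_num) (by norm_num) (by norm_num) (by norm_num) (by norm_num) (by norm_num) (by norm_num) (by norm_num) (by norm_num)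
      h1 h2 (by simp only [Nat.reduceAdd, h5, h4, h3, h2, h1, h0]; abel)
      (by simp only [Nat.reduceAdd, h5, h4, h3, h2, h1, h0]; abel)
    linarith
  · exact many 2 (by norm_num) (by norm_num) (fun i hi hne => by
      interval_cases i <;> first | exact absurd rfl hne | assumption)
  · exact even (by rw [h5, h4, h3, h2, h1, h0] at hy6; simpa only [neg_neg] using hy6)
  · exact even (by rw [h5, h4, h3, h2, h1, h0] at hy6; simpa only [neg_neg] using hy6)
  · have T := three 1 3 2 4 5 (by norm_num) (by norm_num) (by norm_num) (by norm_num) (by norm_num) (by norm_num) (by norm_num) (by norm_num) (by norm_num) (by norm_num) (by norm_num) (by norm_num) (by norm_num)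
      h1 h3 (by simp only [Nat.reduceAdd, h5, h4, h3, h2, h1, h0]; abel)
      (by simp only [Nat.reduceAdd, h5, h4, h3, h2, h1, h0]; abel)
    linarith
  · exact even (by rw [h5, h4, h3, h2, h1, h0] at hy6; simpa only [neg_neg] using hy6)
  · have T := three 1 4 2 3 5 (by norm_num) (by norm_num) (by norm_num) (by norm_num) (by norm_num) (by norm_num) (by norm_num) (by norm_num) (by norm_num) (by norm_num) (by norm_num) (by norm_num) (by norm_num)
      h1 h4 (by simp only [Nat.reduceAdd, h5, h4, h3, h2, h1, h0]; abel)
      (by simp only [Nat.reduceAdd, h5, h4, h3, h2, h1, h0]; abel)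
    linarith
  · have T := three 1 5 2 3 4 (by norm_num) (by norm_num) (by norm_num) (by norm_num) (by norm_num) (by norm_num) (by norm_num) (by norm_num) (by norm_num) (by norm_num) (by norm_num) (by norm_num) (by norm_num)
      h1 h5 (by simp only [Nat.reduceAdd, h5, h4, h3, h2, h1, h0]; abel)
      (by simp only [Nat.reduceAdd, h5, h4, h3, h2, h1, h0]; abel)
    linarith
  · exact even (by rw [h5, h4, h3, h2, h1, h0] at hy6; simpa only [neg_neg] using hy6)
  · exact many 1 (by norm_num) (by norm_num) (fun i hi hne => by
      interval_cases i <;> first | exact absurd rfl hne | assumption)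
  · exact even (by rw [h5, h4, h3, h2, h1, h0] at hy6; simpa only [neg_neg] using hy6)
  · exact even (by rw [h5, h4, h3, h2, h1, h0] at hy6; simpa only [neg_neg] using hy6)
  · have T := three 2 3 1 4 5 (by norm_num) (by norm_num) (by norm_num) (by norm_num) (by norm_num) (by norm_num) (by norm_num) (by norm_num) (by norm_num) (by norm_num) (by norm_num) (by norm_num) (by norm_num)
      h2 h3 (by simp only [Nat.reduceAdd, h5, h4, h3, h2, h1, h0]; abel)
      (by simp only [Nat.reduceAdd, h5, h4, h3, h2, h1, h0]; abel)
    linarith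
  · exact even (by rw [h5, h4, h3, h2, h1, h0] at hy6; simpa only [neg_neg] using hy6)
  · have T := three 2 4 1 3 5 (by norm_num) (by norm_num) (by norm_num) (by norm_num) (by norm_num) (by norm_num) (by norm_num) (by norm_num) (by norm_num) (by norm_num) (by norm_num) (by norm_num) (by norm_num)
      h2 h4 (by simp only [Nat.reduceAdd, h5, h4, h3, h2, h1, h0]; abel)
      (by simp only [Nat.reduceAdd, h5, h4, h3, h2, h1, h0]; abel)
    linarith
  · have T := three 2 5 1 3 4 (by norm_num) (by norm_num) (by norm_num) (by norm_num) (by norm_num) (by norm_num) (by norm_num) (by norm_num) (by norm_num) (by norm_num) (by norm_num) (by norm_num) (by norm_num)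
      h2 h5 (by simp only [Nat.reduceAdd, h5, h4, h3, h2, h1, h0]; abel)
      (by simp only [Nat.reduceAdd, h5, h4, h3, h2, h1, h0]; abel)
    linarith
  · exact even (by rw [h5, h4, h3, h2, h1, h0] at hy6; simpa only [neg_neg] using hy6)
  · exact even (by rw [h5, h4, h3, h2, h1, h0] at hy6; simpa only [neg_neg] using hy6)
  · have T := three 3 4 1 2 5 (by norm_num) (by norm_num) (by norm_num) (by norm_num) (by norm_num) (by norm_num) (by norm_num) (by norm_num) (by norm_num) (by norm_num) (by norm_num) (by norm_num) (by norm_num)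
      h3 h4 (by simp only [Nat.reduceAdd, h5, h4, h3, h2, h1, h0]; abel)
      (by simp only [Nat.reduceAdd, h5, h4, h3, h2, h1, h0]; abel)
    linarith
  · have T := three 3 5 1 2 4 (by norm_num) (by norm_num) (by norm_num) (by norm_num) (by norm_num) (by norm_num) (by norm_num) (by norm_num) (by norm_num) (by norm_num) (by norm_num) (by norm_num) (by norm_num)
      h3 h5 (by simp only [Nat.reduceAdd, h5, h4, h3, h2, h1, h0]; abel)
      (by simp only [Nat.reduceAdd, h5, h4, h3, h2, h1, h0]; abel)
    linarith
  · exact even (by rw [h5, h4, h3, h2, h1, h0] at hy6; simpa only [neg_neg] using hy6)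
  · have T := three 4 5 1 2 3 (by norm_num) (by norm_num) (by norm_num) (by norm_num) (by norm_num) (by norm_num) (by norm_num) (by norm_num) (by norm_num) (by norm_num) (by norm_num) (by norm_num) (by norm_num)
      h4 h5 (by simp only [Nat.reduceAdd, h5, h4, h3, h2, h1, h0]; abel)
      (by simp only [Nat.reduceAdd, h5, h4, h3, h2, h1, h0]; abel)
    linarith
  · exact even (by rw [h5, h4, h3, h2, h1, h0] at hy6; simpa only [neg_neg] using hy6)
  · exact even (by rw [h5, h4, h3, h2, h1, h0] at hy6; simpa only [neg_neg] using hy6)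
  · have T := hdec (fun i hi hi' => by
      interval_cases i <;> simp only [Nat.reduceAdd, h5, h4, h3, h2, h1, h0] <;> abel)
    have T1 := L2 0 1 2 (by norm_num) (by norm_num) (by norm_num) h0
      (by simp only [Nat.reduceAdd, h5, h4, h3, h2, h1, h0]; abel)
    have T2 := L2 0 3 4 (by norm_num) (by norm_num) (by norm_num) h0
      (by simp only [Nat.reduceAdd, h5, h4, h3, h2, h1, h0]; abel)
    linarith

/-- The integer lattice as an additive subgroup. -/
def intSub : AddSubgroup Pt where
  carrier := IntLattice
  zero_mem' := intLattice_zero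
  add_mem' := fun h1 h2 => intLattice_add h1 h2
  neg_mem' := fun h => intLattice_neg h

theorem Dodec.area_gt_of {v : ℕ → Pt} (h : Dodec v)
    (hec : ∀ i, ed v i ∈ IntLattice ∨ v i + v (i + 1) ∈ IntLattice)
    (h0 : ed v 0 ∈ IntLattice) :
    6 < ∑ i ∈ Finset.range 6, cr (v i) (v (i + 1)) := by
  have hq : ∀ x : Pt, (QuotientAddGroup.mk x : Pt ⧸ intSub) = 0 ↔ x ∈ IntLattice :=
    fun x => QuotientAddGroup.eq_zero_iff x
  have hB : ∀ i, (QuotientAddGroup.mk (v (i + 1)) : Pt ⧸ intSub) = QuotientAddGroup.mk (v i) ↔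
      ed v i ∈ IntLattice := by
    intro i
    rw [← hq, ← sub_eq_zero, ← QuotientAddGroup.mk_sub]; rfl
  have hpos : ∀ i j, i < j → j < 6 → 0 < cr (ed v i) (ed v j) := fun i j hij hj =>
    h.ed_pos i j hij (by omega)
  have hS : ∀ i j, (QuotientAddGroup.mk (v (i + 1)) : Pt ⧸ intSub) - QuotientAddGroup.mk (v i)
      + (QuotientAddGroup.mk (v (j + 1)) - QuotientAddGroup.mk (v j)) = 0 →
      ed v i + ed v j ∈ IntLattice := by
    intro i j hh
    rw [← hq]; exact hh
  have hsw : ∀ x y : Pt, cr x y = - cr y x := fun x y => by unfold cr; ring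
  have K := core_s8 (fun i => (QuotientAddGroup.mk (v i) : Pt ⧸ intSub))
    (fun i j => |cr (ed v i) (ed v j)|)
    (fun i j => by rw [hsw, abs_neg])
    (fun i j hij hj => abs_pos.2 (hpos i j hij hj).ne')
    (fun i j hij hj hi hj' => (cr_one_le ((hB i).1 hi) ((hB j).1 hj') (hpos i j hij hj)).trans
      (le_abs_self _))
    (fun l i j hij hj hl hyl hs => by
      have hl' := (hB l).1 hyl
      have hs' := hS i j hs
      have e : cr (ed v l) (ed v i + ed v j) = cr (ed v l) (ed v i) + cr (ed v l) (ed v j) := by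
        simp [cr]; ring
      rcases hl with hl | hl
      · have p1 := hpos l i hl (by omega)
        have p2 := hpos l j (by omega) hj
        have := cr_one_le hl' hs' (by rw [e]; linarith)
        rw [e] at this
        exact this.trans (add_le_add (le_abs_self _) (le_abs_self _))
      · have p1 := hpos i l (by omega) (by omega)
        have p2 := hpos j l (by omega) (by omega)
        rw [hsw] at p1 p2
        have := cr_one_le hs' hl' (by rw [hsw, e]; linarith)
        rw [hsw, e, neg_add] at this
        exact this.trans (add_le_add (neg_le_abs _) (neg_le_abs _)))
    (fun hh => by
      have D := decagon_bound (ed v 1) (ed v 2) (ed v 3) (ed v 4) (ed v 5)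
        (hpos _ _ (by norm_num) (by norm_num)) (hpos _ _ (by norm_num) (by norm_num))
        (hpos _ _ (by norm_num) (by norm_num)) (hpos _ _ (by norm_num) (by norm_num))
        (hpos _ _ (by norm_num) (by norm_num)) (hpos _ _ (by norm_num) (by norm_num))
        (hpos _ _ (by norm_num) (by norm_num)) (hpos _ _ (by norm_num) (by norm_num))
        (hpos _ _ (by norm_num) (by norm_num)) (hpos _ _ (by norm_num) (by norm_num))
        (hS 1 2 (hh 1 (by norm_num) (by norm_num))) (hS 2 3 (hh 2 (by norm_num) (by norm_num)))
        (hS 3 4 (hh 3 (by norm_num) (by norm_num))) (hS 4 5 (hh 4 (by norm_num) (by norm_num)))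
      refine D.trans ?_
      gcongr <;> exact le_abs_self _)
    (by rw [← QuotientAddGroup.mk_neg, ← h.anti 0])
    ((hB 0).2 h0)
    (fun i => by
      rcases hec i with hi | hi
      · exact Or.inl ((hB i).2 hi)
      · right
        rw [← hq, QuotientAddGroup.mk_add, add_comm] at hi
        exact eq_neg_of_add_eq_zero_left hi)
  unfold pairSum at K
  have ab : ∀ i j, i < j → j < 6 → |cr (ed v i) (ed v j)| = cr (ed v i) (ed v j) :=
    fun i j hij hj => abs_of_pos (hpos i j hij hj)
  simp only [] at K
  rw [ab 0 1 (by norm_num) (by norm_num), ab 0 2 (by norm_num) (by norm_num),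
    ab 0 3 (by norm_num) (by norm_num), ab 0 4 (by norm_num) (by norm_num),
    ab 0 5 (by norm_num) (by norm_num), ab 1 2 (by norm_num) (by norm_num),
    ab 1 3 (by norm_num) (by norm_num), ab 1 4 (by norm_num) (by norm_num),
    ab 1 5 (by norm_num) (by norm_num), ab 2 3 (by norm_num) (by norm_num),
    ab 2 4 (by norm_num) (by norm_num), ab 2 5 (by norm_num) (by norm_num),
    ab 3 4 (by norm_num) (by norm_num), ab 3 5 (by norm_num) (by norm_num),
    ab 4 5 (by norm_num) (by norm_num)] at K
  have e6 : v 6 = - v 0 := h.anti 0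
  simp only [Finset.sum_range_succ, Finset.sum_range_zero, Nat.reduceAdd]
  simp only [ed, Nat.reduceAdd, e6, cr, Prod.fst_sub, Prod.snd_sub, Prod.fst_neg,
    Prod.snd_neg] at K ⊢
  linarith

theorem Dodec.rot {v : ℕ → Pt} (h : Dodec v) (r : ℕ) : Dodec (fun i => v (r + i)) where
  anti i := h.anti (r + i)
  pos i j hij hj := h.pos (r + i) (r + j) (by omega) (by omega)
  tri i j l hij hj hl := h.tri (r + i) (r + j) (r + l) (by omega) (by omega) (by omega)

theorem Dodec.area_rot {v : ℕ → Pt} (h : Dodec v) (r : ℕ) :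
    ∑ i ∈ Finset.range 6, cr (v (r + i)) (v (r + i + 1))
      = ∑ i ∈ Finset.range 6, cr (v i) (v (i + 1)) := by
  induction r with
  | zero => simp
  | succ r ih =>
    rw [← ih]
    simp only [Finset.sum_range_succ, Finset.sum_range_zero]
    have e6 := h.anti r
    have e7 := h.anti (r + 1)
    have e8 : cr (v (r + 6)) (v (r + 7)) = cr (v r) (v (r + 1)) := by
      rw [e6, show r + 7 = r + 1 + 6 by ring, e7]; simp [cr]
    ring_nf at e8 ⊢
    linarith

theorem Dodec.area_gt {v : ℕ → Pt} (h : Dodec v)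
    (hec : ∀ i, ed v i ∈ IntLattice ∨ v i + v (i + 1) ∈ IntLattice) :
    6 < ∑ i ∈ Finset.range 6, cr (v i) (v (i + 1)) := by
  by_cases hx : ∃ r, ed v r ∈ IntLattice
  · obtain ⟨r, hr⟩ := hx
    rw [← h.area_rot r]
    exact (h.rot r).area_gt_of (fun i => hec (r + i)) hr
  · exfalso
    push Not at hx
    have hA : ∀ i, v i + v (i + 1) ∈ IntLattice := fun i => (hec i).resolve_left (hx i)
    have e6 : v 6 = - v 0 := h.anti 0
    have s := intLattice_sub (intLattice_add (intLattice_add (hA 0) (hA 2)) (hA 4))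
      (intLattice_add (intLattice_add (hA 1) (hA 3)) (hA 5))
    simp only [Nat.reduceAdd, e6] at s
    have s' := intLattice_sub (hA 0) s
    apply hx 0
    convert s' using 1
    simp only [ed]
    simp only [zero_add]
    abel

section
open MeasureTheory

theorem volume_le_of_pack (U : Set Pt) (hU : MeasurableSet U) (k : ℕ)
    (hk : ∀ p : Pt, {l ∈ IntLattice | p - l ∈ U}.encard ≤ (k : ℕ∞)) : volume U ≤ k := by
  have hcount : Countable intSub := by
    have : (IntLattice).Countable := by
      have : IntLattice = range (fun z : ℤ × ℤ => (((z.1 : ℝ), (z.2 : ℝ)) : Pt)) := by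
        ext p
        constructor
        · rintro ⟨a, b, rfl⟩; exact ⟨(a, b), rfl⟩
        · rintro ⟨z, rfl⟩; exact ⟨z.1, z.2, rfl⟩
      rw [this]; exact countable_range _
    exact this.to_subtype
  set S : Set Pt := Ico (0 : ℝ) 1 ×ˢ Ico (0 : ℝ) 1 with hS
  have hSm : MeasurableSet S := measurableSet_Ico.prod measurableSet_Ico
  have hSv : volume S = 1 := by
    rw [hS, Measure.volume_eq_prod, Measure.prod_prod]; simp
  have hF : IsAddFundamentalDomain intSub S (volume : Measure Pt) := by
    apply IsAddFundamentalDomain.mk' hSm.nullMeasurableSet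
    intro x
    refine ⟨⟨(((-⌊x.1⌋ : ℤ) : ℝ), ((-⌊x.2⌋ : ℤ) : ℝ)), ⟨_, _, rfl⟩⟩, ?_, ?_⟩
    · change ((((-⌊x.1⌋ : ℤ) : ℝ), ((-⌊x.2⌋ : ℤ) : ℝ)) : Pt) + x ∈ S
      have h1 := Int.floor_le x.1
      have h2 := Int.lt_floor_add_one x.1
      have h3 := Int.floor_le x.2
      have h4 := Int.lt_floor_add_one x.2
      simp only [hS, mem_prod, mem_Ico, Prod.fst_add, Prod.snd_add, Int.cast_neg]
      refine ⟨⟨?_, ?_⟩, ?_, ?_⟩ <;> linarith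
    · rintro ⟨g, a, b, rfl⟩ hg
      change (((a : ℝ), (b : ℝ)) : Pt) + x ∈ S at hg
      simp only [hS, mem_prod, mem_Ico, Prod.fst_add, Prod.snd_add] at hg
      obtain ⟨⟨h1, h2⟩, h3, h4⟩ := hg
      have e1 : ⌊x.1⌋ = -a := by
        rw [Int.floor_eq_iff]; push_cast; constructor <;> linarith
      have e2 : ⌊x.2⌋ = -b := by
        rw [Int.floor_eq_iff]; push_cast; constructor <;> linarith
      simp [e1, e2]
  have hptw : ∀ x : Pt, ∑' g : intSub, U.indicator (1 : Pt → ENNReal) (-g +ᵥ x) ≤ k := by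
    intro x
    rw [ENNReal.tsum_eq_iSup_sum]
    apply iSup_le
    intro F
    classical
    have e : ∑ g ∈ F, U.indicator (1 : Pt → ENNReal) (-g +ᵥ x)
        = ((F.filter fun g : intSub => (-g +ᵥ x) ∈ U).card : ENNReal) := by
      rw [Finset.card_filter]
      push_cast
      apply Finset.sum_congr rfl
      intro g _
      simp [indicator_apply]
    rw [e]
    have hle : ((F.filter fun g : intSub => (-g +ᵥ x) ∈ U).card : ℕ∞) ≤ k := by
      refine le_trans ?_ (hk x)
      rw [← Set.encard_coe_eq_coe_finsetCard,
        ← (Subtype.val_injective (p := fun z => z ∈ intSub)).encard_image]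
      apply encard_le_encard
      rintro _ ⟨g, hg, rfl⟩
      simp only [Finset.coe_filter, mem_ofPred_eq] at hg
      refine ⟨g.2, ?_⟩
      have := hg.2
      change -(g : Pt) + x ∈ U at this
      rwa [sub_eq_neg_add]
    have : (F.filter fun g : intSub => (-g +ᵥ x) ∈ U).card ≤ k := by exact_mod_cast hle
    exact_mod_cast this
  calc volume U = ∫⁻ x, U.indicator 1 x := (lintegral_indicator_one hU).symm
    _ = ∑' g : intSub, ∫⁻ x in S, U.indicator 1 (-g +ᵥ x) := hF.lintegral_eq_tsum' _
    _ = ∫⁻ x in S, ∑' g : intSub, U.indicator 1 (-g +ᵥ x) := by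
        rw [lintegral_tsum]
        intro g
        apply Measurable.aemeasurable
        exact (measurable_one.indicator hU).comp (measurable_const_vadd _)
    _ ≤ ∫⁻ x in S, (k : ENNReal) := lintegral_mono fun x => hptw x
    _ = k := by simp [hSv]

theorem volume_tri : ENNReal.ofReal (1 / 2) ≤
    volume {p : Pt | 0 < p.1 ∧ 0 < p.2 ∧ p.1 + p.2 < 1} := by
  have e : {p : Pt | 0 < p.1 ∧ 0 < p.2 ∧ p.1 + p.2 < 1}
      = regionBetween (fun _ => 0) (fun x => 1 - x) (Ioo (0 : ℝ) 1) := by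
    ext p
    simp only [regionBetween, mem_ofPred_eq, mem_Ioo]
    constructor
    · rintro ⟨h1, h2, h3⟩; refine ⟨⟨h1, by linarith⟩, h2, by linarith⟩
    · rintro ⟨⟨h1, h2⟩, h3, h4⟩; exact ⟨h1, h3, by linarith⟩
  rw [e, Measure.volume_eq_prod, volume_regionBetween_eq_integral]
  · apply ENNReal.ofReal_le_ofReal
    rw [← integral_Ioc_eq_integral_Ioo, ← intervalIntegral.integral_of_le zero_le_one]
    have e2 : ∫ x in (0 : ℝ)..1, ((1 : ℝ) - x) = 1 / 2 := by
      rw [intervalIntegral.integral_sub (by simp) (by simp), integral_id]; norm_num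
    simp only [Pi.sub_apply, sub_zero]
    exact e2.ge
  · exact integrableOn_const (by simp)
  · exact ((continuous_const.sub continuous_id).integrableOn_Icc).mono_set Ioo_subset_Icc_self
  · exact measurableSet_Ioo
  · intro x hx; simp at hx ⊢; linarith

theorem volume_lin_tri (a b : Pt) (hab : 0 < cr a b) (W : Set Pt)
    (hW : ∀ s t : ℝ, 0 < s → 0 < t → s + t < 1 → s • a + t • b ∈ W) :
    ENNReal.ofReal (cr a b / 2) ≤ volume W := by
  set f := Matrix.toLin (Module.Basis.finTwoProd ℝ) (Module.Basis.finTwoProd ℝ)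
    !![a.1, b.1; a.2, b.2] with hf
  have hd : LinearMap.det f = cr a b := by
    rw [hf, LinearMap.det_toLin, Matrix.det_fin_two_of, cr]; ring
  calc ENNReal.ofReal (cr a b / 2) = ENNReal.ofReal |LinearMap.det f| * ENNReal.ofReal (1 / 2) := by
        rw [hd, abs_of_pos hab, ← ENNReal.ofReal_mul hab.le]; congr 1; ring
    _ ≤ ENNReal.ofReal |LinearMap.det f| * volume {p : Pt | 0 < p.1 ∧ 0 < p.2 ∧ p.1 + p.2 < 1} := by
        gcongr; exact volume_tri
    _ = volume (f '' {p : Pt | 0 < p.1 ∧ 0 < p.2 ∧ p.1 + p.2 < 1}) :=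
        (Measure.addHaar_image_linearMap _ f _).symm
    _ ≤ volume W := by
        apply measure_mono
        rintro _ ⟨⟨s, t⟩, ⟨h1, h2, h3⟩, rfl⟩
        have := hW s t h1 h2 h3
        rw [hf, Matrix.toLin_finTwoProd_apply]
        convert this using 1
        ext <;> simp <;> ring

/-- Open sectors of the dodecagon. -/
def sector (v : ℕ → Pt) (i : ℕ) : Set Pt := {x | 0 < cr (v i) x ∧ cr (v (i + 1)) x < 0}

theorem Dodec.sector_disj {v : ℕ → Pt} (h : Dodec v) (i j : ℕ) (hij : i < j) (hj : j < i + 6)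
    (x : Pt) (hi : x ∈ sector v i) (hx : x ∈ sector v j) : False := by
  obtain ⟨h1, h2⟩ := hi
  obtain ⟨h3, h4⟩ := hx
  rcases Nat.eq_or_lt_of_le (Nat.succ_le_of_lt hij) with he | he
  · subst he; exact lt_asymm h2 h3
  · have p1 := h.pos (i + 1) j he (by omega)
    have p2 := h.pos (i + 1) (j + 1) (by omega) (by omega)
    have p3 := h.pos j (j + 1) (by omega) (by omega)
    have key : cr (v (i + 1)) x * cr (v j) (v (j + 1)) =
        cr (v (i + 1)) (v j) * (-cr (v (j + 1)) x) + cr (v (i + 1)) (v (j + 1)) * cr (v j) x := by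
      simp only [cr]; ring
    have n1 := mul_neg_of_neg_of_pos h2 p3
    have n2 := mul_pos p1 (neg_pos.2 h4)
    have n3 := mul_pos p2 h3
    linarith

theorem Dodec.sector_disj' {v : ℕ → Pt} (h : Dodec v) (i j : ℕ) (hij : i < j) (hj : j < i + 12)
    (x : Pt) (hi : x ∈ sector v i) (hx : x ∈ sector v j) : False := by
  rcases lt_trichotomy j (i + 6) with hc | hc | hc
  · exact h.sector_disj i j hij hc x hi hx
  · subst hc
    have h1 := hi.1
    have h2 := hx.1
    rw [h.anti] at h2
    simp only [cr, Prod.fst_neg, Prod.snd_neg] at h1 h2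
    linarith
  · refine h.sector_disj j (i + 12) hj (by omega) x hx ?_
    unfold sector at hi ⊢
    rw [h.per, show i + 12 + 1 = i + 1 + 12 by ring, h.per]; exact hi

theorem Dodec.volume_ge {v : ℕ → Pt} (h : Dodec v) :
    ENNReal.ofReal (∑ i ∈ Finset.range 6, cr (v i) (v (i + 1))) ≤
      volume (interior (convexHull ℝ (range v))) := by
  have hc : ∀ i, 0 < cr (v i) (v (i + 1)) := fun i => h.pos i (i + 1) (by omega) (by omega)
  set Q := interior (convexHull ℝ (range v)) with hQ
  have hin : ∀ i (s t : ℝ), 0 < s → 0 < t → s + t < 1 →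
      s • v i + t • v (i + 1) ∈ sector v i ∩ Q := by
    intro i s t hs ht hst
    refine ⟨⟨?_, ?_⟩, ?_⟩
    · have := mul_pos ht (hc i)
      simp only [cr, Prod.fst_add, Prod.snd_add, Prod.smul_fst, Prod.smul_snd, smul_eq_mul] at *
      linarith
    · have := mul_pos hs (hc i)
      simp only [cr, Prod.fst_add, Prod.snd_add, Prod.smul_fst, Prod.smul_snd, smul_eq_mul] at *
      linarith
    · apply h.mem_int
      intro j _
      have e : fg v j (s • v i + t • v (i + 1)) = s * fg v j (v i) + t * fg v j (v (i + 1))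
          + (1 - s - t) * cr (v j) (v (j + 1)) := by
        simp [fg, cr, ed]; ring
      rw [e]
      have p1 := mul_nonneg hs.le (h.fg_nonneg j i)
      have p2 := mul_nonneg ht.le (h.fg_nonneg j (i + 1))
      have p3 := mul_pos (show 0 < 1 - s - t by linarith) (hc j)
      linarith
  have hopen : ∀ i, IsOpen (sector v i ∩ Q) := by
    intro i
    have c1 : Continuous fun x : Pt => cr (v i) x := by unfold cr; fun_prop
    have c2 : Continuous fun x : Pt => cr (v (i + 1)) x := by unfold cr; fun_prop
    exact ((isOpen_lt continuous_const c1).inter (isOpen_lt c2 continuous_const)).inter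
      isOpen_interior
  have hsum : ∑ i ∈ Finset.range 6, cr (v i) (v (i + 1))
      = ∑ i ∈ Finset.range 12, cr (v i) (v (i + 1)) / 2 := by
    have e : ∀ i, cr (v (i + 6)) (v (i + 6 + 1)) = cr (v i) (v (i + 1)) := by
      intro i
      rw [h.anti, show i + 6 + 1 = i + 1 + 6 by ring, h.anti]; simp [cr]
    rw [show 12 = 6 + 6 from rfl, Finset.sum_range_add]
    simp only [add_comm 6, e, ← Finset.sum_add_distrib]
    apply Finset.sum_congr rfl
    intros; ring
  rw [hsum, ENNReal.ofReal_sum_of_nonneg (fun i _ => (half_pos (hc i)).le)]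
  calc ∑ i ∈ Finset.range 12, ENNReal.ofReal (cr (v i) (v (i + 1)) / 2)
      ≤ ∑ i ∈ Finset.range 12, volume (sector v i ∩ Q) :=
        Finset.sum_le_sum fun i _ => volume_lin_tri _ _ (hc i) _ (hin i)
    _ = volume (⋃ i ∈ Finset.range 12, sector v i ∩ Q) := by
        rw [measure_biUnion_finset]
        · intro i hi j hj hij
          simp only [Finset.coe_range, mem_Iio] at hi hj
          refine disjoint_left.2 ?_
          rintro x ⟨hx, _⟩ ⟨hx', _⟩
          rcases Nat.lt_or_gt_of_ne hij with hl | hl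
          · exact h.sector_disj' i j hl (by omega) x hx hx'
          · exact h.sector_disj' j i hl (by omega) x hx' hx
        · intro i _; exact (hopen i).measurableSet
    _ ≤ volume Q := by
        apply measure_mono
        intro x hx
        simp only [mem_iUnion] at hx
        obtain ⟨i, _, hx⟩ := hx
        exact hx.2

end

/-- No `k`-fold tiling by the integer lattice with `k ≤ 6`. -/
theorem Dodec.no_tiling {v : ℕ → Pt} (h : Dodec v) (k : ℕ) (hk : k ≤ 6)
    (hcov : ∀ p : Pt, (k : ℕ∞) ≤ {l ∈ IntLattice | p - l ∈ convexHull ℝ (range v)}.encard)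
    (hpack : ∀ p : Pt,
      {l ∈ IntLattice | p - l ∈ interior (convexHull ℝ (range v))}.encard ≤ (k : ℕ∞))
    (hbd : Bornology.IsBounded (convexHull ℝ (range v))) : False := by
  have h1 := h.area_gt (h.edge_condition k hcov hpack hbd)
  have h2 := h.volume_ge.trans (volume_le_of_pack _ isOpen_interior.measurableSet k hpack)
  have h3 : ENNReal.ofReal (∑ i ∈ Finset.range 6, cr (v i) (v (i + 1))) ≤ ENNReal.ofReal k := by
    rwa [ENNReal.ofReal_natCast]
  rw [ENNReal.ofReal_le_ofReal_iff (by positivity)] at h3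
  have h4 : (k : ℝ) ≤ 6 := by exact_mod_cast hk
  linarith

theorem ext_eq {Q : Set Pt} {v a b : Pt} (hv : v ∈ extremePoints ℝ Q) (ha : a ∈ Q) (hb : b ∈ Q)
    (s t : ℝ) (hs : 0 < s) (ht : 0 < t) (hst : s + t = 1) (h : v = s • a + t • b) : a = v :=
  (mem_extremePoints.1 hv).2 a ha b hb ⟨s, t, hs, ht, hst, h.symm⟩ |>.1

theorem ext_neg {Q : Set Pt} (hsym : ∀ x ∈ Q, -x ∈ Q) {v : Pt} (hv : v ∈ extremePoints ℝ Q) :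
    -v ∈ extremePoints ℝ Q := by
  rw [mem_extremePoints]
  refine ⟨hsym _ hv.1, ?_⟩
  rintro a ha b hb ⟨s, t, hs, ht, hst, h⟩
  have e : v = s • (-a) + t • (-b) := by
    rw [smul_neg, smul_neg, ← neg_add, h, neg_neg]
  have e' : v = t • (-b) + s • (-a) := by rw [e, add_comm]
  constructor
  · rw [← ext_eq hv (hsym _ ha) (hsym _ hb) s t hs ht hst e, neg_neg]
  · rw [← ext_eq hv (hsym _ hb) (hsym _ ha) t s ht hs (by linarith) e', neg_neg]

/-- Nonzero extreme points: `t • w` extreme with `w ∈ Q` forces `1 ≤ |t|`. -/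
theorem ext_scale {Q : Set Pt} (hsym : ∀ x ∈ Q, -x ∈ Q) {v w : Pt} (hv : v ∈ extremePoints ℝ Q)
    (hw : w ∈ Q) (hw0 : w ≠ 0) (t : ℝ) (h : v = t • w) : 1 ≤ |t| := by
  by_contra! hc
  rw [abs_lt] at hc
  have h1 := ext_eq hv hw (hsym _ hw) ((1 + t) / 2) ((1 - t) / 2) (by linarith) (by linarith)
    (by ring) (by rw [h]; ext <;> simp <;> ring)
  have h2 := ext_eq hv (hsym _ hw) hw ((1 - t) / 2) ((1 + t) / 2) (by linarith) (by linarith)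
    (by ring) (by rw [h]; ext <;> simp <;> ring)
  rw [← h1] at h2
  exact hw0 (self_eq_neg.1 h2.symm)

theorem smul_of_cr {v w : Pt} (hw : w ≠ 0) (h : cr v w = 0) : ∃ t : ℝ, v = t • w := by
  unfold cr at h
  by_cases h1 : w.1 = 0
  · have h2 : w.2 ≠ 0 := fun h2 => hw (Prod.ext h1 h2)
    refine ⟨v.2 / w.2, Prod.ext ?_ ?_⟩
    · rw [h1] at h
      have : v.1 = 0 := by
        rcases mul_eq_zero.1 (show v.1 * w.2 = 0 by linarith) with h | h
        · exact h
        · exact absurd h h2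
      simp [h1, this]
    · simp [h2]
  · refine ⟨v.1 / w.1, Prod.ext ?_ ?_⟩
    · simp [h1]
    · simp only [Prod.smul_snd, smul_eq_mul]
      field_simp
      linarith

theorem ext_parallel {Q : Set Pt} (hsym : ∀ x ∈ Q, -x ∈ Q) {v w : Pt}
    (hv : v ∈ extremePoints ℝ Q) (hw : w ∈ extremePoints ℝ Q) (hv0 : v ≠ 0) (hw0 : w ≠ 0)
    (h : cr v w = 0) : v = w ∨ v = -w := by
  obtain ⟨t, ht⟩ := smul_of_cr hw0 h
  have h1 := ext_scale hsym hv hw.1 hw0 t ht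
  have ht0 : t ≠ 0 := by rintro rfl; simp at h1; linarith
  have h2 := ext_scale hsym hw hv.1 hv0 t⁻¹ (by rw [ht, smul_smul, inv_mul_cancel₀ ht0, one_smul])
  rw [abs_inv] at h2
  have h3 : |t| ≤ 1 := by
    have hp : 0 < |t| := abs_pos.2 ht0
    by_contra! hc
    have := inv_lt_one_of_one_lt₀ hc
    linarith
  rcases eq_or_eq_neg_of_abs_eq (le_antisymm h3 h1) with h4 | h4
  · left; rw [ht, h4, one_smul]
  · right; rw [ht, h4, neg_smul, one_smul]

theorem ext_tri {Q : Set Pt} (hc : Convex ℝ Q) (h0 : (0 : Pt) ∈ Q) {a b c : Pt}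
    (ha : a ∈ extremePoints ℝ Q) (hb : b ∈ extremePoints ℝ Q) (hcc : c ∈ extremePoints ℝ Q)
    (h1 : 0 < cr a b) (h2 : 0 < cr b c) (h3 : 0 < cr a c) : cr a c < cr a b + cr b c := by
  by_contra! hcon
  set D := cr a c with hD
  have e : b = (cr b c / D) • a + (cr a b / D) • c := by
    have hne := h3.ne'
    ext
    · simp only [Prod.fst_add, Prod.smul_fst, smul_eq_mul]
      field_simp
      simp only [hD, cr]; ring
    · simp only [Prod.snd_add, Prod.smul_snd, smul_eq_mul]
      field_simp
      simp only [hD, cr]; ring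
  have pα : 0 < cr b c / D := div_pos h2 h3
  have pβ : 0 < cr a b / D := div_pos h1 h3
  have hs : cr b c / D + cr a b / D ≤ 1 := by
    rw [← add_div, div_le_one h3]; linarith
  set α := cr b c / D
  set β := cr a b / D
  have p1 : 0 < 1 - α := by linarith
  have hm : (β / (1 - α)) • c ∈ Q := by
    have := hc hcc.1 h0 (a := β / (1 - α)) (b := 1 - β / (1 - α)) (by positivity)
      (by rw [sub_nonneg, div_le_one p1]; linarith) (by ring)
    simpa using this
  have := ext_eq hb ha.1 hm α (1 - α) pα p1 (by ring) (by
    rw [smul_smul, mul_div_cancel₀ _ p1.ne']; exact e)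
  rw [this] at h1
  simp [cr] at h1
  linarith

theorem exists_dodec (Q : Set Pt) (hc : Convex ℝ Q) (hsym : ∀ x ∈ Q, -x ∈ Q)
    (hfin : (extremePoints ℝ Q).Finite) (hcard : (extremePoints ℝ Q).ncard = 12) :
    ∃ v : ℕ → Pt, Dodec v ∧ range v = extremePoints ℝ Q := by
  classical
  set V := extremePoints ℝ Q with hV
  have hneg : ∀ x ∈ V, -x ∈ V := fun x hx => ext_neg hsym hx
  have hQ0 : (0 : Pt) ∈ Q := by
    obtain ⟨x, hx⟩ := (Set.ncard_pos hfin).1 (by omega : 0 < V.ncard)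
    have := hc hx.1 (hsym x hx.1) (a := 1/2) (b := 1/2) (by norm_num) (by norm_num) (by norm_num)
    simpa using this
  have hV0 : (0 : Pt) ∉ V := by
    intro h
    have : ∃ w ∈ V, w ≠ 0 := by
      by_contra! hcon
      have : V ⊆ {0} := fun x hx => hcon x hx
      have := Set.ncard_le_ncard this
      simp at this
      omega
    obtain ⟨w, hw, hw0⟩ := this
    have := ext_scale hsym h hw.1 hw0 0 (by simp)
    simp at this
    linarith
  have hne : ∀ x ∈ V, x ≠ 0 := fun x hx h => hV0 (h ▸ hx)
  obtain ⟨t, ht⟩ : ∃ t : ℝ, ∀ x ∈ V, x.1 + t * x.2 ≠ 0 := by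
    obtain ⟨t, ht⟩ := (hfin.image fun x => -x.1 / x.2).exists_notMem
    refine ⟨t, fun x hx h => ?_⟩
    by_cases h2 : x.2 = 0
    · rw [h2] at h
      exact hne x hx (Prod.ext (by simpa using h) h2)
    · apply ht
      refine ⟨x, hx, ?_⟩
      simp only []
      field_simp
      linarith
  set u : Pt → ℝ := fun x => x.1 + t * x.2 with hu
  have hun : ∀ x, u (-x) = -u x := fun x => by simp [hu]; ring
  set H : Finset Pt := hfin.toFinset.filter (fun x => 0 < u x) with hH
  have memH : ∀ x, x ∈ H ↔ x ∈ V ∧ 0 < u x := by intro x; simp [hH]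
  have hHc : H.card = 6 := by
    have e : hfin.toFinset = H ∪ H.image (fun x => -x) := by
      ext x
      simp only [Finset.mem_union, Finset.mem_image, Finite.mem_toFinset, memH]
      constructor
      · intro hx
        rcases lt_or_gt_of_ne (ht x hx) with hl | hl
        · right; refine ⟨-x, ⟨hneg x hx, ?_⟩, neg_neg x⟩
          rw [hun]; exact neg_pos.2 hl
        · left; exact ⟨hx, hl⟩
      · rintro (⟨h, _⟩ | ⟨y, ⟨h, _⟩, rfl⟩)
        · exact h
        · exact hneg y h
    have hd : Disjoint H (H.image (fun x => -x)) := by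
      rw [Finset.disjoint_left]
      intro x hx hx'
      rw [Finset.mem_image] at hx'
      obtain ⟨y, hy, rfl⟩ := hx'
      have h1 := ((memH _).1 hx).2
      have h2 := ((memH _).1 hy).2
      rw [hun] at h1
      linarith
    have h12 : hfin.toFinset.card = 12 := by rw [← hcard, Set.ncard_eq_toFinset_card _ hfin]
    rw [e, Finset.card_union_of_disjoint hd, Finset.card_image_of_injective _ neg_injective] at h12
    omega
  set σ : Pt → ℝ := fun x => x.2 / u x with hσ
  have hcr : ∀ x y, x ∈ H → y ∈ H → cr x y = u x * u y * (σ y - σ x) := by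
    intro x y hx hy
    have h1 := ((memH _).1 hx).2.ne'
    have h2 := ((memH _).1 hy).2.ne'
    have : cr x y = u x * y.2 - x.2 * u y := by simp only [cr, hu]; ring
    rw [this]
    simp only [hσ]
    field_simp
  have hinj : ∀ x ∈ H, ∀ y ∈ H, σ x = σ y → x = y := by
    intro x hx y hy he
    have h1 : cr x y = 0 := by rw [hcr x y hx hy, he]; ring
    have hx' := (memH _).1 hx
    have hy' := (memH _).1 hy
    rcases ext_parallel hsym hx'.1 hy'.1 (hne x hx'.1) (hne y hy'.1) h1 with h | h
    · exact h
    · exfalso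
      have := hx'.2
      rw [h, hun] at this
      linarith [hy'.2]
  have hSc : (H.image σ).card = 6 := by
    rw [Finset.card_image_of_injOn (fun x hx y hy h => hinj x hx y hy h), hHc]
  set em := (H.image σ).orderEmbOfFin hSc with hem
  have hw : ∀ i, ∃ x ∈ H, σ x = em i := fun i => by
    exact Finset.mem_image.1 (Finset.orderEmbOfFin_mem (H.image σ) hSc i)
  choose w hwH hwσ using hw
  have hwsurj : ∀ x ∈ H, ∃ i, w i = x := by
    intro x hx
    have : σ x ∈ Set.range em := by
      rw [hem, Finset.range_orderEmbOfFin]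
      exact Finset.mem_coe.2 (Finset.mem_image_of_mem _ hx)
    obtain ⟨i, hi⟩ := this
    exact ⟨i, hinj _ (hwH i) _ hx (by rw [hwσ, hi])⟩
  have hwpos : ∀ i j, i < j → 0 < cr (w i) (w j) := by
    intro i j hij
    rw [hcr _ _ (hwH i) (hwH j), hwσ, hwσ]
    have := em.strictMono hij
    exact mul_pos (mul_pos ((memH _).1 (hwH i)).2 ((memH _).1 (hwH j)).2) (by linarith)
  set v : ℕ → Pt := fun n => ((-1 : ℝ) ^ (n / 6)) • w ⟨n % 6, Nat.mod_lt _ (by norm_num)⟩ with hv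
  have hsgn : ∀ n : ℕ, (-1 : ℝ) ^ n = 1 ∨ (-1 : ℝ) ^ n = -1 := fun n => neg_one_pow_eq_or ℝ n
  have hvV : ∀ n, v n ∈ V := by
    intro n
    have h1 := ((memH _).1 (hwH ⟨n % 6, Nat.mod_lt _ (by norm_num)⟩)).1
    simp only [hv]
    rcases hsgn (n / 6) with h | h
    · rw [h, one_smul]; exact h1
    · rw [h, neg_smul, one_smul]; exact hneg _ h1
  have anti : ∀ i, v (i + 6) = -v i := by
    intro i
    simp only [hv]
    have e1 : (i + 6) / 6 = i / 6 + 1 := by omega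
    simp [e1, pow_succ]
  have crs : ∀ (a b : ℝ) (x y : Pt), cr (a • x) (b • y) = a * b * cr x y := by
    intro a b x y; simp [cr]; ring
  have pos : ∀ i j, i < j → j < i + 6 → 0 < cr (v i) (v j) := by
    intro i j hij hj
    simp only [hv]
    rw [crs]
    by_cases hq : j / 6 = i / 6
    · rw [hq]
      have h1 : (-1 : ℝ) ^ (i / 6) * (-1) ^ (i / 6) = 1 := by
        rcases hsgn (i / 6) with h | h <;> rw [h] <;> norm_num
      rw [h1, one_mul]
      apply hwpos
      rw [Fin.mk_lt_mk]
      omega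
    · have hq' : j / 6 = i / 6 + 1 := by omega
      rw [hq', pow_succ]
      have h1 : (-1 : ℝ) ^ (i / 6) * ((-1) ^ (i / 6) * -1) = -1 := by
        rcases hsgn (i / 6) with h | h <;> rw [h] <;> norm_num
      rw [h1]
      have := hwpos ⟨j % 6, Nat.mod_lt _ (by norm_num)⟩ ⟨i % 6, Nat.mod_lt _ (by norm_num)⟩ (by
        rw [Fin.mk_lt_mk]; omega)
      unfold cr at this ⊢
      linarith
  refine ⟨v, ⟨anti, pos, ?_⟩, ?_⟩
  · intro i j l hij hjl hl
    exact ext_tri hc hQ0 (hvV i) (hvV j) (hvV l) (pos i j hij (by omega))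
      (pos j l hjl (by omega)) (pos i l (by omega) hl)
  · apply Subset.antisymm
    · rintro _ ⟨n, rfl⟩; exact hvV n
    · intro x hx
      have hvw : ∀ i : Fin 6, v i = w i := by
        intro i
        simp only [hv]
        have e1 : (i : ℕ) / 6 = 0 := by omega
        have e2 : (i : ℕ) % 6 = i := by omega
        simp [e1, e2]
      rcases lt_or_gt_of_ne (ht x hx) with hl | hl
      · obtain ⟨i, hi⟩ := hwsurj (-x) ((memH _).2 ⟨hneg x hx, by rw [hun]; exact neg_pos.2 hl⟩)
        refine ⟨i + 6, ?_⟩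
        rw [anti, hvw, hi, neg_neg]
      · obtain ⟨i, hi⟩ := hwsurj x ((memH _).2 ⟨hx, hl⟩)
        exact ⟨i, by rw [hvw, hi]⟩

/-- a centrally symmetric convex dodecagon admits no `k`-fold lattice tiling of
the plane for any positive `k ≤ 6`; that is, `τ*(P) ≥ 7`. -/
theorem dodecagon_lattice_ge_seven (P : Set Pt) (hP : IsConvexPolygon P 12)
    (hsym : CentrallySymmetric P) :
    ∀ (L : Set Pt) (k : ℕ), 0 < k → k ≤ 6 → ¬IsKFoldLatticeTiling P L k := by
  intro L k _ hk hT
  obtain ⟨⟨B, rfl⟩, hcov, hpack⟩ := hT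
  obtain ⟨c, hc⟩ := hsym
  obtain ⟨hconv, hcomp, _, hfin, hcard, _⟩ := hP
  set φ : Pt ≃ₜ Pt := B.toContinuousLinearEquiv.toHomeomorph.trans (Homeomorph.addRight c) with hφ
  have hφa : ∀ x, φ x = B x + c := fun x => rfl
  set Q : Set Pt := φ ⁻¹' P with hQ
  have hlin : ∀ (s t : ℝ) (a b : Pt), s + t = 1 → φ (s • a + t • b) = s • φ a + t • φ b := by
    intro s t a b hst
    have ht : t = 1 - s := by linarith
    subst ht
    simp only [hφa, map_add, map_sub, map_smul, smul_add, sub_smul, one_smul]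
    abel
  have hQconv : Convex ℝ Q := by
    intro a ha b hb s t hs ht hst
    change φ _ ∈ P
    rw [hlin s t a b hst]
    exact hconv ha hb hs ht hst
  have hQsym : ∀ x ∈ Q, -x ∈ Q := by
    intro x hx
    have h1 := (hc (φ x)).1 hx
    change φ (-x) ∈ P
    convert h1 using 1
    simp only [hφa, map_neg]
    abel
  have hext : extremePoints ℝ Q = φ ⁻¹' extremePoints ℝ P := by
    ext x
    rw [mem_preimage, mem_extremePoints, mem_extremePoints]
    refine and_congr Iff.rfl ⟨?_, ?_⟩
    · rintro h a ha b hb ⟨s, t, hs, ht, hst, e⟩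
      have key := h (φ.symm a) (by simpa [hQ] using ha) (φ.symm b) (by simpa [hQ] using hb)
        ⟨s, t, hs, ht, hst, φ.injective (by rw [hlin s t _ _ hst]; simpa using e)⟩
      rw [← key.1]
      refine ⟨by simp, ?_⟩
      rw [key.1, ← key.2]; simp
    · rintro h a ha b hb ⟨s, t, hs, ht, hst, e⟩
      have key := h (φ a) ha (φ b) hb ⟨s, t, hs, ht, hst, by rw [← hlin s t a b hst, e]⟩
      exact ⟨φ.injective key.1, φ.injective key.2⟩
  have hQfin : (extremePoints ℝ Q).Finite := by
    rw [hext]; exact hfin.preimage φ.injective.injOn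
  have hQcard : (extremePoints ℝ Q).ncard = 12 := by
    rw [hext, ← hcard]
    exact Set.ncard_preimage_of_injective_subset_range φ.injective (by simp)
  have hQcomp : IsCompact Q := φ.isCompact_preimage.2 hcomp
  have hQint : interior Q = φ ⁻¹' interior P := (φ.preimage_interior P).symm
  obtain ⟨v, hv, hr⟩ := exists_dodec Q hQconv hQsym hQfin hQcard
  have hhull : convexHull ℝ (range v) = Q := by
    rw [hr]
    have h1 := closure_convexHull_extremePoints hQcomp hQconv
    rwa [(hQfin.isCompact_convexHull (𝕜 := ℝ)).isClosed.closure_eq] at h1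
  have hcount : ∀ (K : Set Pt) (q : Pt),
      {l ∈ B '' IntLattice | φ q - l ∈ K}.encard = {l ∈ IntLattice | q - l ∈ φ ⁻¹' K}.encard := by
    intro K q
    rw [← B.injective.encard_image {l ∈ IntLattice | q - l ∈ φ ⁻¹' K}]
    congr 1
    ext l
    have e : ∀ m, φ q - B m = φ (q - m) := fun m => by
      simp only [hφa, map_sub]; abel
    constructor
    · rintro ⟨⟨m, hm, rfl⟩, hl⟩
      refine ⟨m, ⟨hm, ?_⟩, rfl⟩
      rw [mem_preimage, ← e]; exact hl
    · rintro ⟨m, ⟨hm, hl⟩, rfl⟩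
      refine ⟨⟨m, hm, rfl⟩, ?_⟩
      rw [mem_preimage, ← e] at hl; exact hl
  refine hv.no_tiling k hk ?_ ?_ ?_
  · intro q
    rw [hhull, hQ, ← hcount]; exact hcov _
  · intro q
    rw [hhull, hQint, ← hcount]; exact hpack _
  · rw [hhull]; exact hQcomp.isBounded
end
end
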